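/- arXiv:2510.04018 — 5 statements merged into one kernel-verified Lean document; each statement's English description precedes it below -/
import Mathlib

section
/- For every δ > 0 there exists N(δ) such that the following holds for every n ≥ N(δ). Let t be an integer with δn ≤ t ≤ (2n−6)/9 − 2, let H be an n-vertex graph containing no t+2 pairwise vertex-disjoint triangles and having exactly ex(n,(t+1)K3) + 2 edges, let (T, M, I) be a maximal tiling triple of H and let (T1, T2, T3, T4) be an ideal partition of T. Then: (i) t−1 ≤ |T1| ≤ t+1; (ii) (n−3(t+1))/2 − √(2n)/2 < |M| ≤ (n−3(t+1))/2; and (iii) |I| < √(2n). -/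
open Finset

/-- `H` contains `k` pairwise vertex-disjoint triangles. -/
def HasKDisjointTriangles {n : ℕ} (H : SimpleGraph (Fin n)) (k : ℕ) : Prop :=
  ∃ T : Finset (Finset (Fin n)), T.card = k ∧ (∀ s ∈ T, H.IsNClique 3 s) ∧
    (T : Set (Finset (Fin n))).Pairwise fun s₁ s₂ => Disjoint s₁ s₂

/-- Under the edge-coloring `χ`, the graph `H` contains a rainbow copy of `k`
pairwise vertex-disjoint triangles. -/
def HasRainbowKTriangles {n : ℕ} (H : SimpleGraph (Fin n)) (χ : Sym2 (Fin n) → ℕ)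
    (k : ℕ) : Prop :=
  ∃ T : Finset (Finset (Fin n)), T.card = k ∧ (∀ s ∈ T, H.IsNClique 3 s) ∧
    ((T : Set (Finset (Fin n))).Pairwise fun s₁ s₂ => Disjoint s₁ s₂) ∧
    Set.InjOn χ {e : Sym2 (Fin n) | ¬ e.IsDiag ∧ ∃ s ∈ T, ∀ x ∈ e, x ∈ s}

/-- `χ` is a surjective edge-coloring of `K_n` with colors `{1, …, N}`. -/
def IsSurjColoring (n N : ℕ) (χ : Sym2 (Fin n) → ℕ) : Prop :=
  (∀ e : Sym2 (Fin n), ¬ e.IsDiag → χ e ∈ Finset.Icc 1 N) ∧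
  (∀ c ∈ Finset.Icc 1 N, ∃ e : Sym2 (Fin n), ¬ e.IsDiag ∧ χ e = c)

/-- `ex(n, kK₃)`: the maximum number of edges of an `n`-vertex graph containing no `k`
pairwise vertex-disjoint triangles. -/
noncomputable def exTriangles (n k : ℕ) : ℕ :=
  sSup {m : ℕ | ∃ H : SimpleGraph (Fin n), ¬ HasKDisjointTriangles H k ∧
    H.edgeSet.ncard = m}

/-- `H` is a representative graph of the `N`-coloring `χ`: it is rainbow and has
exactly `N` edges. -/
def IsRepGraph {n : ℕ} (χ : Sym2 (Fin n) → ℕ) (N : ℕ) (H : SimpleGraph (Fin n)) : Prop :=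
  H.edgeSet.ncard = N ∧ Set.InjOn χ H.edgeSet

/-- The edge `e` (a set of two vertices) sees the vertex `w` of the triangle `s`:
`w ∈ s` and both endpoints of `e` are adjacent to `w` in `H`. -/
def seesAt {n : ℕ} (H : SimpleGraph (Fin n)) (e s : Finset (Fin n)) (w : Fin n) : Prop :=
  w ∈ s ∧ ∀ u ∈ e, H.Adj u w

/-- The edge `e` sees the triangle `s`. -/
def sees {n : ℕ} (H : SimpleGraph (Fin n)) (e s : Finset (Fin n)) : Prop :=
  ∃ w, seesAt H e s w

/-- The vertex `p` sees the triangle `s`: `p` is adjacent to two distinct vertices of `s`. -/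
def vertexSees {n : ℕ} (H : SimpleGraph (Fin n)) (p : Fin n) (s : Finset (Fin n)) : Prop :=
  ∃ w₁ ∈ s, ∃ w₂ ∈ s, w₁ ≠ w₂ ∧ H.Adj p w₁ ∧ H.Adj p w₂

/-- The triangle `u` sees the triangle `s`: some edge of `u` sees `s`. -/
def triSees {n : ℕ} (H : SimpleGraph (Fin n)) (u s : Finset (Fin n)) : Prop :=
  ∃ a ∈ u, ∃ b ∈ u, a ≠ b ∧ sees H {a, b} s

/-- `(T, M, I)` is a tiling triple of `H`: `T` is a family of pairwise vertex-disjoint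
triangles, `M` is a matching, `I` is an independent set, and `V(T), V(M), I` partition
the vertex set. -/
def IsTilingTriple {n : ℕ} (H : SimpleGraph (Fin n)) (T M : Finset (Finset (Fin n)))
    (I : Finset (Fin n)) : Prop :=
  (∀ s ∈ T, H.IsNClique 3 s) ∧ (∀ e ∈ M, H.IsNClique 2 e) ∧
  (∀ x ∈ I, ∀ y ∈ I, ¬ H.Adj x y) ∧
  (((T ∪ M : Finset (Finset (Fin n))) : Set (Finset (Fin n))).Pairwise
    fun s₁ s₂ => Disjoint s₁ s₂) ∧
  Disjoint ((T ∪ M).biUnion id) I ∧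
  (T ∪ M).biUnion id ∪ I = Finset.univ

/-- `(T, M, I)` is a tiling triple of `H` with `(|T|, |M|)` lexicographically maximal. -/
def IsMaxTilingTriple {n : ℕ} (H : SimpleGraph (Fin n)) (T M : Finset (Finset (Fin n)))
    (I : Finset (Fin n)) : Prop :=
  IsTilingTriple H T M I ∧
  ∀ T' M' : Finset (Finset (Fin n)), ∀ I' : Finset (Fin n), IsTilingTriple H T' M' I' →
    T'.card < T.card ∨ (T'.card = T.card ∧ M'.card ≤ M.card)

/-- The number of edges of `H` between the (disjoint) vertex sets `A` and `B`. -/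
noncomputable def eBetween {n : ℕ} (H : SimpleGraph (Fin n)) (A B : Set (Fin n)) : ℕ :=
  Set.ncard {p : Fin n × Fin n | p.1 ∈ A ∧ p.2 ∈ B ∧ H.Adj p.1 p.2}

/-- `(T₁, T₂, T₃, T₄)` is an ideal partition of `T` for the tiling triple `(T, M, I)`:
`T₁` consists of the triangles of `T` seen by at least two edges of `M`; `T₂` consists of
the triangles of `T ∖ T₁` seen by at least two other members of `T`, or by one edge of
`M` and at least one vertex of `I`; and `(T₃, T₄)` arises from the greedy removal process
on `D = T ∖ (T₁ ∪ T₂)`: while some triangle of `D` sends at most `8(|D|−1)` edges to the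
other triangles of `D`, it is removed (the removed triangles, in order, form `T₃`),
and `T₄` is the final set `D`, in which every triangle sends more than `8(|T₄|−1)`
edges to the other triangles of `T₄`. -/
def IsIdealPartition {n : ℕ} (H : SimpleGraph (Fin n)) (T M : Finset (Finset (Fin n)))
    (I : Finset (Fin n)) (T₁ T₂ T₃ T₄ : Finset (Finset (Fin n))) : Prop :=
  T₁ ∪ T₂ ∪ T₃ ∪ T₄ = T ∧
  Disjoint T₁ T₂ ∧ Disjoint T₁ T₃ ∧ Disjoint T₁ T₄ ∧
  Disjoint T₂ T₃ ∧ Disjoint T₂ T₄ ∧ Disjoint T₃ T₄ ∧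
  (∀ s, s ∈ T₁ ↔ s ∈ T ∧ ∃ e₁ ∈ M, ∃ e₂ ∈ M, e₁ ≠ e₂ ∧ sees H e₁ s ∧ sees H e₂ s) ∧
  (∀ s, s ∈ T₂ ↔ s ∈ T ∧ s ∉ T₁ ∧
    ((∃ s₁ ∈ T, ∃ s₂ ∈ T, s₁ ≠ s₂ ∧ s₁ ≠ s ∧ s₂ ≠ s ∧ triSees H s₁ s ∧ triSees H s₂ s) ∨
      ((∃ e ∈ M, sees H e s) ∧ (∃ p ∈ I, vertexSees H p s)))) ∧
  (∃ k : ℕ, ∃ g : Fin k → Finset (Fin n), Function.Injective g ∧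
    Finset.image g Finset.univ = T₃ ∧
    ∀ j : Fin k,
      eBetween H (↑(g j))
          (↑((((Finset.univ.filter fun i : Fin k => j < i).image g) ∪ T₄).biUnion id))
        ≤ 8 * (k - (j : ℕ) + T₄.card - 1)) ∧
  (∀ s ∈ T₄, 8 * (T₄.card - 1) < eBetween H (↑s) (↑((T₄.erase s).biUnion id)))

/-- `x` is the critical vertex of the triangle `s` (with respect to the matching `M`):
some edge of `M` sees `x` of `s`, and every edge of `M` seeing `s` sees only `x` of `s`. -/
def IsCriticalVertex {n : ℕ} (H : SimpleGraph (Fin n)) (M : Finset (Finset (Fin n)))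
    (s : Finset (Fin n)) (x : Fin n) : Prop :=
  x ∈ s ∧ (∃ e ∈ M, seesAt H e s x) ∧ ∀ e ∈ M, ∀ w, seesAt H e s w → w = x

/-- The set of non-critical vertices of the triangles in `T₁`. -/
def nonCriticalVerts {n : ℕ} (H : SimpleGraph (Fin n)) (M T₁ : Finset (Finset (Fin n))) :
    Set (Fin n) :=
  {w | ∃ s ∈ T₁, ∃ x, IsCriticalVertex H M s x ∧ w ∈ s ∧ w ≠ x}

section Exchange

variable {n : ℕ} {H : SimpleGraph (Fin n)} {T M : Finset (Finset (Fin n))} {I : Finset (Fin n)}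

open Classical in
/-- The member of `T ∪ M` containing `v`, or `∅` if there is none. -/
noncomputable def partOf (T M : Finset (Finset (Fin n))) (v : Fin n) : Finset (Fin n) :=
  if h : ∃ s ∈ T ∪ M, v ∈ s then h.choose else ∅

lemma partOf_spec {v : Fin n} (h : partOf T M v ≠ ∅) :
    partOf T M v ∈ T ∪ M ∧ v ∈ partOf T M v := by
  unfold partOf at h ⊢
  split_ifs at h ⊢ with h'
  · exact h'.choose_spec
  · exact absurd rfl h

lemma IsTilingTriple.partOf_eq (h : IsTilingTriple H T M I) {s : Finset (Fin n)}
    (hs : s ∈ T ∪ M) {v : Fin n} (hv : v ∈ s) : partOf T M v = s := by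
  have h' : ∃ s ∈ T ∪ M, v ∈ s := ⟨s, hs, hv⟩
  unfold partOf
  rw [dif_pos h']
  by_contra hne
  exact Finset.disjoint_left.1 (h.2.2.2.1 (by exact_mod_cast h'.choose_spec.1)
    (by exact_mod_cast hs) hne) h'.choose_spec.2 hv

lemma IsTilingTriple.empty_notMem_left (h : IsTilingTriple H T M I) : ∅ ∉ T :=
  fun h0 => by simpa using (h.1 _ h0).2

lemma IsTilingTriple.empty_notMem_right (h : IsTilingTriple H T M I) : ∅ ∉ M :=
  fun h0 => by simpa using (h.2.1 _ h0).2

lemma IsTilingTriple.notMem_right (h : IsTilingTriple H T M I) {s : Finset (Fin n)}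
    (hs : s ∈ T) : s ∉ M := fun hM => by
  have h1 := (h.1 _ hs).2
  have h2 := (h.2.1 _ hM).2
  omega

lemma IsTilingTriple.partOf_eq_empty (h : IsTilingTriple H T M I) {v : Fin n} :
    partOf T M v = ∅ ↔ v ∈ I := by
  constructor
  · intro hv
    have := h.2.2.2.2.2 ▸ Finset.mem_univ v
    rcases Finset.mem_union.1 this with h1 | h1
    · obtain ⟨s, hs, hvs⟩ := Finset.mem_biUnion.1 h1
      rw [h.partOf_eq hs hvs] at hv
      subst hv
      simp at hvs
    · exact h1
  · intro hv
    by_contra hne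
    have := partOf_spec hne
    exact Finset.disjoint_left.1 h.2.2.2.2.1
      (Finset.mem_biUnion.2 ⟨_, this.1, this.2⟩) hv

lemma exists_isTilingTriple {T' M' : Finset (Finset (Fin n))}
    (hT : ∀ s ∈ T', H.IsNClique 3 s) (hM : ∀ e ∈ M', H.IsNClique 2 e)
    (hd : ((T' ∪ M' : Finset (Finset (Fin n))) : Set (Finset (Fin n))).Pairwise
      fun s₁ s₂ => Disjoint s₁ s₂) :
    ∃ M'' I', M' ⊆ M'' ∧ IsTilingTriple H T' M'' I' := by
  classical
  let P : Finset (Finset (Fin n)) → Prop := fun N => M' ⊆ N ∧ (∀ e ∈ N, H.IsNClique 2 e) ∧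
    ((T' ∪ N : Finset (Finset (Fin n))) : Set (Finset (Fin n))).Pairwise
      fun s₁ s₂ => Disjoint s₁ s₂
  obtain ⟨N, hN, hmax⟩ := Finset.exists_max_image (Finset.univ.filter P) Finset.card
    ⟨M', by simp only [Finset.mem_filter, Finset.mem_univ, true_and]; exact ⟨subset_rfl, hM, hd⟩⟩
  obtain ⟨hMN, hN2, hNd⟩ : P N := (Finset.mem_filter.1 hN).2
  refine ⟨N, Finset.univ \ (T' ∪ N).biUnion id, hMN, hT, hN2, ?_, hNd,
    Finset.disjoint_sdiff, by simp⟩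
  intro x hx y hy hxy
  have hx' : ∀ s ∈ T' ∪ N, x ∉ s := fun s hs hxs =>
    (Finset.mem_sdiff.1 hx).2 (Finset.mem_biUnion.2 ⟨s, hs, hxs⟩)
  have hy' : ∀ s ∈ T' ∪ N, y ∉ s := fun s hs hxs =>
    (Finset.mem_sdiff.1 hy).2 (Finset.mem_biUnion.2 ⟨s, hs, hxs⟩)
  have hdis : ∀ s ∈ T' ∪ N, Disjoint s {x, y} := by
    intro s hs
    rw [Finset.disjoint_right]
    intro a ha
    rcases Finset.mem_insert.1 ha with rfl | ha
    · exact hx' s hs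
    · rw [Finset.mem_singleton.1 ha]; exact hy' s hs
  have hnot : ({x, y} : Finset (Fin n)) ∉ N := fun hmem =>
    hx' _ (Finset.mem_union_right _ hmem) (by simp)
  have hP : P (insert {x, y} N) := by
    refine ⟨hMN.trans (Finset.subset_insert _ _), ?_, ?_⟩
    · intro e he
      rcases Finset.mem_insert.1 he with rfl | he
      · refine ⟨?_, Finset.card_pair hxy.ne⟩
        rw [Finset.coe_pair, SimpleGraph.isClique_pair]
        exact fun _ => hxy
      · exact hN2 e he
    · intro s hs s' hs' hne
      have key : ∀ s, s ∈ (↑(T' ∪ insert {x, y} N) : Set (Finset (Fin n))) →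
          s = {x, y} ∨ s ∈ T' ∪ N := by
        intro s hs
        simp only [Finset.coe_union, Finset.coe_insert, Set.mem_union, Set.mem_insert_iff,
          Finset.mem_coe] at hs
        simp only [Finset.mem_union]
        tauto
      rcases key s hs with rfl | h1 <;> rcases key s' hs' with rfl | h2
      · exact absurd rfl hne
      · exact (hdis _ h2).symm
      · exact hdis _ h1
      · exact hNd (by exact_mod_cast h1) (by exact_mod_cast h2) hne
  have := hmax _ (Finset.mem_filter.2 ⟨Finset.mem_univ _, hP⟩)
  rw [Finset.card_insert_of_notMem hnot] at this
  omega

lemma IsMaxTilingTriple.card_le (h : IsMaxTilingTriple H T M I)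
    {T' M' : Finset (Finset (Fin n))}
    (hT : ∀ s ∈ T', H.IsNClique 3 s) (hM : ∀ e ∈ M', H.IsNClique 2 e)
    (hd : ((T' ∪ M' : Finset (Finset (Fin n))) : Set (Finset (Fin n))).Pairwise
      fun s₁ s₂ => Disjoint s₁ s₂) :
    T'.card < T.card ∨ (T'.card = T.card ∧ M'.card ≤ M.card) := by
  obtain ⟨M'', I', hsub, htil⟩ := exists_isTilingTriple hT hM hd
  rcases h.2 _ _ _ htil with h1 | h1
  · exact Or.inl h1
  · exact Or.inr ⟨h1.1, (Finset.card_le_card hsub).trans h1.2⟩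

lemma IsMaxTilingTriple.replace (h : IsMaxTilingTriple H T M I)
    {S R S' R' : Finset (Finset (Fin n))} (hS : S ⊆ T) (hR : R ⊆ M)
    (hS' : ∀ s ∈ S', H.IsNClique 3 s) (hR' : ∀ e ∈ R', H.IsNClique 2 e)
    (hd : ((S' ∪ R' : Finset (Finset (Fin n))) : Set (Finset (Fin n))).Pairwise
      fun s₁ s₂ => Disjoint s₁ s₂)
    (hp : ∀ s ∈ S' ∪ R', ∀ v ∈ s,
      partOf T M v ∈ S ∨ partOf T M v ∈ R ∨ partOf T M v = ∅)
    (hc : S.card ≤ S'.card) : S'.card = S.card ∧ R'.card ≤ R.card := by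
  have hold : ∀ s ∈ (T \ S) ∪ (M \ R), ∀ s' ∈ S' ∪ R', Disjoint s s' := by
    intro s hs s' hs'
    rw [Finset.disjoint_left]
    intro v hv hv'
    have hmem : s ∈ T ∪ M :=
      Finset.union_subset_union Finset.sdiff_subset Finset.sdiff_subset hs
    have hpv := hp s' hs' v hv'
    rw [h.1.partOf_eq hmem hv] at hpv
    rcases Finset.mem_union.1 hs with h1 | h1
    · rw [Finset.mem_sdiff] at h1
      rcases hpv with h2 | h2 | h2
      · exact h1.2 h2
      · exact h.1.notMem_right h1.1 (hR h2)
      · exact h.1.empty_notMem_left (h2 ▸ h1.1)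
    · rw [Finset.mem_sdiff] at h1
      rcases hpv with h2 | h2 | h2
      · exact h.1.notMem_right (hS h2) h1.1
      · exact h1.2 h2
      · exact h.1.empty_notMem_right (h2 ▸ h1.1)
  have hne : ∀ s ∈ S' ∪ R', s.Nonempty := by
    intro s hs
    rw [← Finset.card_pos]
    rcases Finset.mem_union.1 hs with h1 | h1
    · rw [(hS' s h1).2]; omega
    · rw [(hR' s h1).2]; omega
  have hST : Disjoint (T \ S) S' := Finset.disjoint_left.2 fun s hs hs' => by
    have := hold s (Finset.mem_union_left _ hs) s (Finset.mem_union_left _ hs')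
    exact (hne s (Finset.mem_union_left _ hs')).ne_empty
      (Finset.disjoint_self_iff_empty s |>.1 this)
  have hRM : Disjoint (M \ R) R' := Finset.disjoint_left.2 fun s hs hs' => by
    have := hold s (Finset.mem_union_right _ hs) s (Finset.mem_union_right _ hs')
    exact (hne s (Finset.mem_union_right _ hs')).ne_empty
      (Finset.disjoint_self_iff_empty s |>.1 this)
  have key := h.card_le (T' := (T \ S) ∪ S') (M' := (M \ R) ∪ R') ?_ ?_ ?_
  · rw [Finset.card_union_of_disjoint hST, Finset.card_union_of_disjoint hRM,
      Finset.card_sdiff_of_subset hS, Finset.card_sdiff_of_subset hR] at key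
    have := Finset.card_le_card hS
    have := Finset.card_le_card hR
    omega
  · intro s hs
    rcases Finset.mem_union.1 hs with h1 | h1
    · exact h.1.1 s (Finset.mem_sdiff.1 h1).1
    · exact hS' s h1
  · intro s hs
    rcases Finset.mem_union.1 hs with h1 | h1
    · exact h.1.2.1 s (Finset.mem_sdiff.1 h1).1
    · exact hR' s h1
  · have split : ∀ s, s ∈ (↑((T \ S) ∪ S' ∪ ((M \ R) ∪ R')) : Set (Finset (Fin n))) →
        s ∈ (T \ S) ∪ (M \ R) ∨ s ∈ S' ∪ R' := by
      intro s hs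
      rw [Finset.mem_coe] at hs
      simp only [Finset.mem_union] at hs ⊢
      tauto
    intro s hs s' hs' hne'
    rcases split s hs with h1 | h1 <;> rcases split s' hs' with h2 | h2
    · have hsub : (T \ S) ∪ (M \ R) ⊆ T ∪ M :=
        Finset.union_subset_union Finset.sdiff_subset Finset.sdiff_subset
      exact h.1.2.2.2.1 (by exact_mod_cast hsub h1) (by exact_mod_cast hsub h2) hne'
    · exact hold s h1 s' h2
    · exact (hold s' h2 s h1).symm
    · exact hd (by exact_mod_cast h1) (by exact_mod_cast h2) hne'

/-- The vertices of a list of triples. -/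
def tripleVerts (L : List (Fin n × Fin n × Fin n)) : List (Fin n) :=
  L.flatMap fun p => [p.1, p.2.1, p.2.2]

/-- The vertex set of a triple. -/
def tripleSet (p : Fin n × Fin n × Fin n) : Finset (Fin n) := {p.1, p.2.1, p.2.2}

lemma isNClique_tripleSet {p : Fin n × Fin n × Fin n}
    (h : H.Adj p.1 p.2.1 ∧ H.Adj p.1 p.2.2 ∧ H.Adj p.2.1 p.2.2) :
    H.IsNClique 3 (tripleSet p) := by
  rw [tripleSet, SimpleGraph.is3Clique_triple_iff]
  exact h

lemma pairwise_disjoint_tripleSet {L : List (Fin n × Fin n × Fin n)}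
    (h : (tripleVerts L).Nodup) : (L.map tripleSet).Pairwise Disjoint := by
  rw [List.pairwise_map]
  refine (List.nodup_flatMap.1 h).2.imp ?_
  intro p q hpq
  rw [Finset.disjoint_left]
  intro v hv hv'
  refine hpq (a := v) ?_ ?_
  · simpa [tripleSet] using hv
  · simpa [tripleSet] using hv'

lemma nodup_tripleSet {L : List (Fin n × Fin n × Fin n)}
    (h : (tripleVerts L).Nodup) : (L.map tripleSet).Nodup := by
  have h1 := pairwise_disjoint_tripleSet h
  rw [List.pairwise_map] at h1
  refine List.pairwise_map.2 (h1.imp ?_)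
  intro p q hpq heq
  rw [heq] at hpq
  have := (Finset.disjoint_self_iff_empty _).1 hpq
  simp [tripleSet] at this

lemma mem_tripleVerts {L : List (Fin n × Fin n × Fin n)} {s : Finset (Fin n)}
    (hs : s ∈ (L.map tripleSet).toFinset) {v : Fin n} (hv : v ∈ s) : v ∈ tripleVerts L := by
  rw [List.mem_toFinset, List.mem_map] at hs
  obtain ⟨p, hp, rfl⟩ := hs
  exact List.mem_flatMap.2 ⟨p, hp, by simpa [tripleSet] using hv⟩

lemma IsMaxTilingTriple.false_of_triangles (h : IsMaxTilingTriple H T M I)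
    (S : List (Finset (Fin n))) (L : List (Fin n × Fin n × Fin n))
    (hS : ∀ s ∈ S, s ∈ T) (hlen : S.length < L.length)
    (hL : ∀ p ∈ L, H.Adj p.1 p.2.1 ∧ H.Adj p.1 p.2.2 ∧ H.Adj p.2.1 p.2.2)
    (hnd : (tripleVerts L).Nodup)
    (hp : ∀ v ∈ tripleVerts L, partOf T M v ∈ S ∨ partOf T M v ∉ T) : False := by
  have hcard : (L.map tripleSet).toFinset.card = L.length := by
    rw [List.toFinset_card_of_nodup (nodup_tripleSet hnd), List.length_map]
  have hS2 : S.toFinset.card ≤ S.length := List.toFinset_card_le S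
  have := h.replace (S := S.toFinset) (R := M) (S' := (L.map tripleSet).toFinset) (R' := ∅)
    (fun s hs => hS s (List.mem_toFinset.1 hs)) subset_rfl ?_ (by simp) ?_ ?_ (by omega)
  · omega
  · intro s hs
    rw [List.mem_toFinset, List.mem_map] at hs
    obtain ⟨p, hp', rfl⟩ := hs
    exact isNClique_tripleSet (hL p hp')
  · intro s hs s' hs' hne
    rw [Finset.union_empty, Finset.mem_coe, List.mem_toFinset] at hs hs'
    exact (pairwise_disjoint_tripleSet hnd).forall hs hs' hne
  · intro s hs v hv
    rw [Finset.union_empty] at hs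
    rcases hp v (mem_tripleVerts hs hv) with h1 | h1
    · exact Or.inl (List.mem_toFinset.2 h1)
    · by_cases h0 : partOf T M v = ∅
      · exact Or.inr (Or.inr h0)
      · rcases Finset.mem_union.1 (partOf_spec h0).1 with h2 | h2
        · exact absurd h2 h1
        · exact Or.inr (Or.inl h2)

lemma IsMaxTilingTriple.false_of_triangles_of_edge (h : IsMaxTilingTriple H T M I)
    (S : List (Finset (Fin n))) (L : List (Fin n × Fin n × Fin n)) (x y : Fin n)
    (hS : ∀ s ∈ S, s ∈ T) (hlen : S.length ≤ L.length)
    (hL : ∀ p ∈ L, H.Adj p.1 p.2.1 ∧ H.Adj p.1 p.2.2 ∧ H.Adj p.2.1 p.2.2)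
    (hxy : H.Adj x y)
    (hnd : (x :: y :: tripleVerts L).Nodup)
    (hp : ∀ v ∈ x :: y :: tripleVerts L, partOf T M v ∈ S ∨ partOf T M v = ∅) : False := by
  have hnd' : (tripleVerts L).Nodup := (List.nodup_cons.1 (List.nodup_cons.1 hnd).2).2
  have hcard : (L.map tripleSet).toFinset.card = L.length := by
    rw [List.toFinset_card_of_nodup (nodup_tripleSet hnd'), List.length_map]
  have hS2 : S.toFinset.card ≤ S.length := List.toFinset_card_le S
  have hx : x ∉ tripleVerts L := fun hx =>
    (List.nodup_cons.1 hnd).1 (List.mem_cons_of_mem _ hx)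
  have hy : y ∉ tripleVerts L := (List.nodup_cons.1 (List.nodup_cons.1 hnd).2).1
  have hdis : ∀ s ∈ (L.map tripleSet).toFinset, Disjoint s {x, y} := by
    intro s hs
    rw [Finset.disjoint_left]
    intro v hv hv'
    have := mem_tripleVerts hs hv
    rcases Finset.mem_insert.1 hv' with rfl | hv'
    · exact hx this
    · rw [Finset.mem_singleton.1 hv'] at this
      exact hy this
  have := h.replace (S := S.toFinset) (R := ∅) (S' := (L.map tripleSet).toFinset)
    (R' := {{x, y}})
    (fun s hs => hS s (List.mem_toFinset.1 hs)) (by simp) ?_ ?_ ?_ ?_ (by omega)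
  · simp at this
  · intro s hs
    rw [List.mem_toFinset, List.mem_map] at hs
    obtain ⟨p, hp', rfl⟩ := hs
    exact isNClique_tripleSet (hL p hp')
  · intro e he
    rw [Finset.mem_singleton.1 he]
    refine ⟨?_, Finset.card_pair hxy.ne⟩
    rw [Finset.coe_pair, SimpleGraph.isClique_pair]
    exact fun _ => hxy
  · intro s hs s' hs' hne
    rw [Finset.mem_coe, Finset.mem_union, Finset.mem_singleton] at hs hs'
    rcases hs with hs | rfl <;> rcases hs' with hs' | rfl
    · rw [List.mem_toFinset] at hs hs'
      exact (pairwise_disjoint_tripleSet hnd').forall hs hs' hne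
    · exact hdis s hs
    · exact (hdis s' hs').symm
    · exact absurd rfl hne
  · intro s hs v hv
    have hv' : v ∈ x :: y :: tripleVerts L := by
      rw [Finset.mem_union, Finset.mem_singleton] at hs
      rcases hs with hs | rfl
      · exact List.mem_cons_of_mem _ (List.mem_cons_of_mem _ (mem_tripleVerts hs hv))
      · simp only [Finset.mem_insert, Finset.mem_singleton] at hv
        rcases hv with rfl | rfl <;> simp
    rcases hp v hv' with h1 | h1
    · exact Or.inl (List.mem_toFinset.2 h1)
    · exact Or.inr (Or.inr h1)

end Exchange

section LocalStructure

variable {n : ℕ} {H : SimpleGraph (Fin n)} {T M : Finset (Finset (Fin n))} {I : Finset (Fin n)}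

/-- The vertices `a`, `b`, `c` are those of the triangle `s ∈ T`. -/
structure IsLabelling (H : SimpleGraph (Fin n)) (T M : Finset (Finset (Fin n)))
    (s : Finset (Fin n)) (a b c : Fin n) : Prop where
  mem : s ∈ T
  eq : s = {a, b, c}
  ab : H.Adj a b
  ac : H.Adj a c
  bc : H.Adj b c
  pa : partOf T M a = s
  pb : partOf T M b = s
  pc : partOf T M c = s

lemma IsLabelling.swap {s : Finset (Fin n)} {a b c : Fin n} (h : IsLabelling H T M s a b c) :
    IsLabelling H T M s b a c :=
  ⟨h.mem, by rw [h.eq]; ext; simp; tauto, h.ab.symm, h.bc, h.ac, h.pb, h.pa, h.pc⟩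

lemma IsLabelling.rotate {s : Finset (Fin n)} {a b c : Fin n} (h : IsLabelling H T M s a b c) :
    IsLabelling H T M s b c a :=
  ⟨h.mem, by rw [h.eq]; ext; simp; tauto, h.bc, h.ab.symm, h.ac.symm, h.pb, h.pc, h.pa⟩

lemma IsTilingTriple.isLabelling (h : IsTilingTriple H T M I) {s : Finset (Fin n)} (hs : s ∈ T)
    {a b c : Fin n} (heq : s = {a, b, c}) : IsLabelling H T M s a b c := by
  have h3 := h.1 s hs
  have hp : ∀ v ∈ s, partOf T M v = s := fun v hv =>
    h.partOf_eq (Finset.mem_union_left _ hs) hv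
  have h3' := h3
  rw [heq, SimpleGraph.is3Clique_triple_iff] at h3'
  exact ⟨hs, heq, h3'.1, h3'.2.1, h3'.2.2, hp a (by simp [heq]), hp b (by simp [heq]),
    hp c (by simp [heq])⟩

lemma IsTilingTriple.exists_isLabelling (h : IsTilingTriple H T M I) {s : Finset (Fin n)}
    (hs : s ∈ T) : ∃ a b c, IsLabelling H T M s a b c := by
  obtain ⟨a, b, c, -, -, -, heq⟩ := Finset.card_eq_three.1 (h.1 s hs).2
  exact ⟨a, b, c, h.isLabelling hs heq⟩

lemma IsTilingTriple.exists_isLabelling_of_mem (h : IsTilingTriple H T M I) {s : Finset (Fin n)}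
    (hs : s ∈ T) {a : Fin n} (ha : a ∈ s) : ∃ b c, IsLabelling H T M s a b c := by
  obtain ⟨x, y, z, hl⟩ := h.exists_isLabelling hs
  have := hl.eq ▸ ha
  simp only [Finset.mem_insert, Finset.mem_singleton] at this
  rcases this with rfl | rfl | rfl
  · exact ⟨_, _, hl⟩
  · exact ⟨_, _, hl.rotate⟩
  · exact ⟨_, _, hl.rotate.rotate⟩

lemma IsTilingTriple.exists_isLabelling_of_mem_of_mem (h : IsTilingTriple H T M I)
    {s : Finset (Fin n)} (hs : s ∈ T) {a b : Fin n} (ha : a ∈ s) (hb : b ∈ s) (hab : a ≠ b) :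
    ∃ c, IsLabelling H T M s a b c := by
  obtain ⟨y, z, hl⟩ := h.exists_isLabelling_of_mem hs ha
  have := hl.eq ▸ hb
  simp only [Finset.mem_insert, Finset.mem_singleton] at this
  rcases this with rfl | rfl | rfl
  · exact absurd rfl hab
  · exact ⟨_, hl⟩
  · exact ⟨_, hl.rotate.rotate.swap⟩

lemma vertexSees_iff (h : IsTilingTriple H T M I) {s : Finset (Fin n)} (hs : s ∈ T) {p : Fin n} :
    vertexSees H p s ↔ ∃ a b c, IsLabelling H T M s a b c ∧ H.Adj p a ∧ H.Adj p b := by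
  constructor
  · rintro ⟨a, ha, b, hb, hab, h1, h2⟩
    obtain ⟨c, hc⟩ := h.exists_isLabelling_of_mem_of_mem hs ha hb hab
    exact ⟨a, b, c, hc, h1, h2⟩
  · rintro ⟨a, b, c, hl, h1, h2⟩
    exact ⟨a, by rw [hl.eq]; simp, b, by rw [hl.eq]; simp, hl.ab.ne, h1, h2⟩

/-- The edge `uv` of the matching member `e` is completed to a triangle by `x`. -/
structure IsSeeingEdge (H : SimpleGraph (Fin n)) (T M : Finset (Finset (Fin n)))
    (e : Finset (Fin n)) (u v x : Fin n) : Prop where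
  mem : e ∈ M
  uv : H.Adj u v
  pu : partOf T M u = e
  pv : partOf T M v = e
  ux : H.Adj u x
  vx : H.Adj v x

lemma IsTilingTriple.exists_isSeeingEdge (h : IsTilingTriple H T M I) {e s : Finset (Fin n)}
    (he : e ∈ M) {x : Fin n} (hx : seesAt H e s x) : ∃ u v, IsSeeingEdge H T M e u v x := by
  obtain ⟨u, v, huv, heq⟩ := Finset.card_eq_two.1 (h.2.1 e he).2
  have hcl := h.2.1 e he
  have hu : u ∈ e := by simp [heq]
  have hv : v ∈ e := by simp [heq]
  exact ⟨u, v, he, hcl.1 (by exact_mod_cast hu) (by exact_mod_cast hv) huv,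
    h.partOf_eq (Finset.mem_union_right _ he) hu, h.partOf_eq (Finset.mem_union_right _ he) hv,
    hx.2 u hu, hx.2 v hv⟩

/-- `s ∈ T` has vertices `x`, `y`, `z`, and at least two members of `M` see it at `x`. -/
structure IsCriticalLabelling (H : SimpleGraph (Fin n)) (T M : Finset (Finset (Fin n)))
    (s : Finset (Fin n)) (x y z : Fin n) : Prop where
  lab : IsLabelling H T M s x y z
  seen : ∀ f : Finset (Fin n), ∃ e u v, e ≠ f ∧ IsSeeingEdge H T M e u v x

lemma IsMaxTilingTriple.not_triangle (h : IsMaxTilingTriple H T M I) {a b c : Fin n}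
    (ha : partOf T M a ∉ T) (hb : partOf T M b ∉ T) (hc : partOf T M c ∉ T)
    (hab : H.Adj a b) (hac : H.Adj a c) (hbc : H.Adj b c) : False := by
  refine h.false_of_triangles [] [(a, b, c)] (by simp) (by simp) (by simp [*]) ?_ ?_
  · simp [tripleVerts, hab.ne, hac.ne, hbc.ne]
  · simp [tripleVerts, *]

lemma IsSeeingEdge.notMem (h : IsMaxTilingTriple H T M I) {e : Finset (Fin n)} {u v x : Fin n}
    (he : IsSeeingEdge H T M e u v x) : e ∉ T := fun hT => h.1.notMem_right hT he.mem

lemma IsMaxTilingTriple.exists_isCriticalLabelling (h : IsMaxTilingTriple H T M I)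
    {s e₁ e₂ : Finset (Fin n)} (hs : s ∈ T) (h1 : e₁ ∈ M) (h2 : e₂ ∈ M) (hne : e₁ ≠ e₂)
    (hs1 : sees H e₁ s) (hs2 : sees H e₂ s) : ∃ x y z, IsCriticalLabelling H T M s x y z := by
  obtain ⟨x, hx⟩ := hs1
  obtain ⟨y, hy⟩ := hs2
  obtain ⟨u₁, v₁, E1⟩ := h.1.exists_isSeeingEdge h1 hx
  obtain ⟨u₂, v₂, E2⟩ := h.1.exists_isSeeingEdge h2 hy
  have n1 := E1.notMem h
  have n2 := E2.notMem h
  by_cases hxy : x = y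
  · subst hxy
    obtain ⟨b, c, hl⟩ := h.1.exists_isLabelling_of_mem hs hx.1
    refine ⟨x, b, c, hl, fun f => ?_⟩
    by_cases hf : e₁ = f
    · exact ⟨e₂, u₂, v₂, fun h => hne (hf.trans h.symm), E2⟩
    · exact ⟨e₁, u₁, v₁, hf, E1⟩
  · exfalso
    obtain ⟨z, hl⟩ := h.1.exists_isLabelling_of_mem_of_mem hs hx.1 hy.1 hxy
    obtain ⟨-, huv1, pu1, pv1, ux1, vx1⟩ := E1
    obtain ⟨-, huv2, pu2, pv2, ux2, vx2⟩ := E2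
    obtain ⟨-, -, ab, ac, bc, pa, pb, pc⟩ := hl
    refine h.false_of_triangles [s] [(u₁, v₁, x), (u₂, v₂, y)] (by simp [*]) (by simp)
      (by simp [*]) ?_ ?_
    · simp [tripleVerts]
      repeat' apply And.intro
      all_goals first
        | exact SimpleGraph.Adj.ne (by assumption)
        | exact SimpleGraph.Adj.ne' (by assumption)
        | grind -ext
    · simp [tripleVerts, *]

lemma IsCriticalLabelling.not_adj (h : IsMaxTilingTriple H T M I) {s : Finset (Fin n)}
    {x y z p : Fin n} (hs : IsCriticalLabelling H T M s x y z) (hp : partOf T M p ∉ T)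
    (hy : H.Adj p y) (hz : H.Adj p z) : False := by
  obtain ⟨e, u, v, hne, E⟩ := hs.seen (partOf T M p)
  have n1 := E.notMem h
  obtain ⟨-, huv1, pu1, pv1, ux1, vx1⟩ := E
  obtain ⟨hsT, -, ab, ac, bc, pa, pb, pc⟩ := hs.lab
  refine h.false_of_triangles [s] [(u, v, x), (p, y, z)] (by simp [*]) (by simp)
    (by simp [*]) ?_ ?_
  · simp [tripleVerts]
    repeat' apply And.intro
    all_goals first
      | exact SimpleGraph.Adj.ne (by assumption)
      | exact SimpleGraph.Adj.ne' (by assumption)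
      | grind -ext
  · simp [tripleVerts, *]

lemma IsCriticalLabelling.not_triangle_three (h : IsMaxTilingTriple H T M I)
    {s₁ s₂ s₃ : Finset (Fin n)} {x₁ y₁ z₁ x₂ y₂ z₂ a b c : Fin n}
    (hs1 : IsCriticalLabelling H T M s₁ x₁ y₁ z₁) (hs2 : IsCriticalLabelling H T M s₂ x₂ y₂ z₂)
    (hs3 : IsLabelling H T M s₃ a b c) (h12 : s₁ ≠ s₂) (h13 : s₁ ≠ s₃) (h23 : s₂ ≠ s₃)
    (ay : H.Adj a y₁) (az : H.Adj a z₁) (bY : H.Adj b y₂) (bz : H.Adj b z₂) : False := by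
  obtain ⟨e, u, v, -, E⟩ := hs1.seen ∅
  obtain ⟨e', u', v', hne, E'⟩ := hs2.seen e
  have n1 := E.notMem h
  have n2 := E'.notMem h
  obtain ⟨-, huv, pu, pv, ux, vx⟩ := E
  obtain ⟨-, huv', pu', pv', ux', vx'⟩ := E'
  obtain ⟨hsT, -, xy1, xz1, yz1, px1, py1, pz1⟩ := hs1.lab
  obtain ⟨hsT2, -, xy2, xz2, yz2, px2, py2, pz2⟩ := hs2.lab
  obtain ⟨hsT3, -, ab, ac, bc, pa, pb, pc⟩ := hs3
  refine h.false_of_triangles [s₁, s₂, s₃] [(u, v, x₁), (u', v', x₂), (a, y₁, z₁), (b, y₂, z₂)]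
    (by simp [*]) (by simp) (by simp [*]) ?_ ?_
  · simp [tripleVerts]
    repeat' apply And.intro
    all_goals first
      | exact SimpleGraph.Adj.ne (by assumption)
      | exact SimpleGraph.Adj.ne' (by assumption)
      | grind -ext
  · simp [tripleVerts, *]

lemma IsCriticalLabelling.swap {s : Finset (Fin n)} {x y z : Fin n}
    (h : IsCriticalLabelling H T M s x y z) : IsCriticalLabelling H T M s x z y :=
  ⟨h.lab.rotate.rotate.swap, h.seen⟩

lemma IsCriticalLabelling.not_adj_critical (h : IsMaxTilingTriple H T M I)
    {s₁ s₂ : Finset (Fin n)} {x₁ y₁ z₁ x₂ y₂ z₂ : Fin n}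
    (hs1 : IsCriticalLabelling H T M s₁ x₁ y₁ z₁) (hs2 : IsCriticalLabelling H T M s₂ x₂ y₂ z₂)
    (h12 : s₁ ≠ s₂) (hy : H.Adj y₂ y₁) (hz : H.Adj y₂ z₁) : False := by
  obtain ⟨e, u, v, -, E⟩ := hs1.seen ∅
  obtain ⟨e', u', v', hne, E'⟩ := hs2.seen e
  have n1 := E.notMem h
  obtain ⟨-, huv1, pu1, pv1, ux1, vx1⟩ := E
  have n2 := E'.notMem h
  obtain ⟨-, huv2, pu2, pv2, ux2, vx2⟩ := E'
  obtain ⟨hsT1, -, ab1, ac1, bc1, pa1, pb1, pc1⟩ := hs1.lab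
  obtain ⟨hsT2, -, ab2, ac2, bc2, pa2, pb2, pc2⟩ := hs2.lab
  refine h.false_of_triangles [s₁, s₂] [(u, v, x₁), (u', v', x₂), (y₂, y₁, z₁)]
    (by simp [*]) (by simp) (by simp [*]) ?_ ?_
  · simp [tripleVerts]
    repeat' apply And.intro
    all_goals first
      | exact SimpleGraph.Adj.ne (by assumption)
      | exact SimpleGraph.Adj.ne' (by assumption)
      | grind -ext
  · simp [tripleVerts, *]

lemma IsCriticalLabelling.not_adj_of_vertex (h : IsMaxTilingTriple H T M I)
    {s₁ s₂ : Finset (Fin n)} {x y z a b c p : Fin n}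
    (hs1 : IsCriticalLabelling H T M s₁ x y z) (hs2 : IsLabelling H T M s₂ a b c)
    (h12 : s₁ ≠ s₂) (hp : partOf T M p ∉ T) (pa : H.Adj p a) (pb : H.Adj p b)
    (hy : H.Adj c y) (hz : H.Adj c z) : False := by
  obtain ⟨e, u, v, hne, E⟩ := hs1.seen (partOf T M p)
  have n1 := E.notMem h
  obtain ⟨-, huv1, pu1, pv1, ux1, vx1⟩ := E
  obtain ⟨hsT1, -, ab1, ac1, bc1, pa1, pb1, pc1⟩ := hs1.lab
  obtain ⟨hsT2, -, ab2, ac2, bc2, pa2, pb2, pc2⟩ := hs2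
  refine h.false_of_triangles [s₁, s₂] [(u, v, x), (p, a, b), (c, y, z)]
    (by simp [*]) (by simp) (by simp [*]) ?_ ?_
  · simp [tripleVerts]
    repeat' apply And.intro
    all_goals first
      | exact SimpleGraph.Adj.ne (by assumption)
      | exact SimpleGraph.Adj.ne' (by assumption)
      | grind -ext
  · simp [tripleVerts, *]

lemma IsLabelling.not_adj_of_two_vertices (h : IsMaxTilingTriple H T M I)
    {s₁ s₂ : Finset (Fin n)} {a b c a' b' c' p q : Fin n}
    (hs1 : IsLabelling H T M s₁ a b c) (hs2 : IsLabelling H T M s₂ a' b' c')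
    (h12 : s₁ ≠ s₂) (hp : partOf T M p = ∅) (hq : partOf T M q = ∅) (hpq : p ≠ q)
    (pa : H.Adj p a) (pb : H.Adj p b) (qa : H.Adj q a') (qb : H.Adj q b')
    (hc : H.Adj c c') : False := by
  have h0 := h.1.empty_notMem_left
  obtain ⟨hsT1, -, ab1, ac1, bc1, pa1, pb1, pc1⟩ := hs1
  obtain ⟨hsT2, -, ab2, ac2, bc2, pa2, pb2, pc2⟩ := hs2
  refine h.false_of_triangles_of_edge [s₁, s₂] [(p, a, b), (q, a', b')] c c'
    (by simp [*]) (by simp) (by simp [*]) (by assumption) ?_ ?_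
  · simp [tripleVerts]
    repeat' apply And.intro
    all_goals first
      | exact SimpleGraph.Adj.ne (by assumption)
      | exact SimpleGraph.Adj.ne' (by assumption)
      | grind -ext
  · simp [tripleVerts, *]

lemma IsLabelling.not_adj_of_edge_of_vertex (h : IsMaxTilingTriple H T M I)
    {s₁ s₂ e : Finset (Fin n)} {a b c a' b' c' p u v : Fin n}
    (hs1 : IsLabelling H T M s₁ a b c) (hs2 : IsLabelling H T M s₂ a' b' c')
    (h12 : s₁ ≠ s₂) (hp : partOf T M p = ∅) (E : IsSeeingEdge H T M e u v a)
    (pa : H.Adj p a') (pb : H.Adj p b') (hb : H.Adj c' b) (hc : H.Adj c' c) : False := by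
  have h0 := h.1.empty_notMem_left
  have h0' : e ≠ ∅ := fun he => h.1.empty_notMem_right (he ▸ E.mem)
  have n1 := E.notMem h
  obtain ⟨-, huv1, pu1, pv1, ux1, vx1⟩ := E
  obtain ⟨hsT1, -, ab1, ac1, bc1, pa1, pb1, pc1⟩ := hs1
  obtain ⟨hsT2, -, ab2, ac2, bc2, pa2, pb2, pc2⟩ := hs2
  refine h.false_of_triangles [s₁, s₂] [(u, v, a), (p, a', b'), (c', b, c)]
    (by simp [*]) (by simp) (by simp [*]) ?_ ?_
  · simp [tripleVerts]
    repeat' apply And.intro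
    all_goals first
      | exact SimpleGraph.Adj.ne (by assumption)
      | exact SimpleGraph.Adj.ne' (by assumption)
      | grind -ext
  · simp [tripleVerts, *]

lemma IsLabelling.not_adj_three_of_two_vertices (h : IsMaxTilingTriple H T M I)
    {s₁ s₂ s₃ : Finset (Fin n)} {a₁ b₁ c₁ a₂ b₂ c₂ a₃ b₃ c₃ p q : Fin n}
    (hs1 : IsLabelling H T M s₁ a₁ b₁ c₁) (hs2 : IsLabelling H T M s₂ a₂ b₂ c₂)
    (hs3 : IsLabelling H T M s₃ a₃ b₃ c₃) (h12 : s₁ ≠ s₂) (h13 : s₁ ≠ s₃) (h23 : s₂ ≠ s₃)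
    (hp : partOf T M p = ∅) (hq : partOf T M q = ∅) (hpq : p ≠ q)
    (pa : H.Adj p a₁) (pb : H.Adj p b₁) (qa : H.Adj q a₂) (qb : H.Adj q b₂)
    (hca : H.Adj c₁ a₃) (hcb : H.Adj c₁ b₃) (hcc : H.Adj c₂ c₃) : False := by
  have h0 := h.1.empty_notMem_left
  obtain ⟨hsT1, -, ab1, ac1, bc1, pa1, pb1, pc1⟩ := hs1
  obtain ⟨hsT2, -, ab2, ac2, bc2, pa2, pb2, pc2⟩ := hs2
  obtain ⟨hsT3, -, ab3, ac3, bc3, pa3, pb3, pc3⟩ := hs3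
  refine h.false_of_triangles_of_edge [s₁, s₂, s₃] [(p, a₁, b₁), (q, a₂, b₂), (c₁, a₃, b₃)] c₂ c₃
    (by simp [*]) (by simp) (by simp [*]) (by assumption) ?_ ?_
  · simp [tripleVerts]
    repeat' apply And.intro
    all_goals first
      | exact SimpleGraph.Adj.ne (by assumption)
      | exact SimpleGraph.Adj.ne' (by assumption)
      | grind -ext
  · simp [tripleVerts, *]

lemma IsLabelling.not_adj_three_of_edge_of_vertex (h : IsMaxTilingTriple H T M I)
    {s₁ s₂ s₃ e : Finset (Fin n)} {a₁ b₁ c₁ a₂ b₂ c₂ a₃ b₃ c₃ p u v : Fin n}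
    (hs1 : IsLabelling H T M s₁ a₁ b₁ c₁) (hs2 : IsLabelling H T M s₂ a₂ b₂ c₂)
    (hs3 : IsLabelling H T M s₃ a₃ b₃ c₃) (h12 : s₁ ≠ s₂) (h13 : s₁ ≠ s₃) (h23 : s₂ ≠ s₃)
    (hp : partOf T M p = ∅) (E : IsSeeingEdge H T M e u v a₁)
    (pa : H.Adj p a₂) (pb : H.Adj p b₂) (hb : H.Adj b₁ a₃) (hc : H.Adj c₁ a₃)
    (hcb : H.Adj c₂ b₃) (hcc : H.Adj c₂ c₃) : False := by
  have h0 := h.1.empty_notMem_left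
  have h0' : e ≠ ∅ := fun he => h.1.empty_notMem_right (he ▸ E.mem)
  have n1 := E.notMem h
  obtain ⟨-, huv1, pu1, pv1, ux1, vx1⟩ := E
  obtain ⟨hsT1, -, ab1, ac1, bc1, pa1, pb1, pc1⟩ := hs1
  obtain ⟨hsT2, -, ab2, ac2, bc2, pa2, pb2, pc2⟩ := hs2
  obtain ⟨hsT3, -, ab3, ac3, bc3, pa3, pb3, pc3⟩ := hs3
  refine h.false_of_triangles [s₁, s₂, s₃] [(u, v, a₁), (p, a₂, b₂), (b₁, c₁, a₃), (c₂, b₃, c₃)]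
    (by simp [*]) (by simp) (by simp [*]) ?_ ?_
  · simp [tripleVerts]
    repeat' apply And.intro
    all_goals first
      | exact SimpleGraph.Adj.ne (by assumption)
      | exact SimpleGraph.Adj.ne' (by assumption)
      | grind -ext
  · simp [tripleVerts, *]

lemma IsLabelling.not_adj_of_vertex (h : IsMaxTilingTriple H T M I)
    {s : Finset (Fin n)} {a b c p q : Fin n} (hs : IsLabelling H T M s a b c)
    (hp : partOf T M p = ∅) (hq : partOf T M q = ∅) (hpq : p ≠ q)
    (pa : H.Adj p a) (pb : H.Adj p b) (qc : H.Adj q c) : False := by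
  have h0 := h.1.empty_notMem_left
  obtain ⟨hsT1, -, ab1, ac1, bc1, pa1, pb1, pc1⟩ := hs
  refine h.false_of_triangles_of_edge [s] [(p, a, b)] q c
    (by simp [*]) (by simp) (by simp [*]) (by assumption) ?_ ?_
  · simp [tripleVerts]
    repeat' apply And.intro
    all_goals first
      | exact SimpleGraph.Adj.ne (by assumption)
      | exact SimpleGraph.Adj.ne' (by assumption)
      | grind -ext
  · simp [tripleVerts, *]

lemma IsLabelling.not_seeing_of_vertex (h : IsMaxTilingTriple H T M I)
    {s e : Finset (Fin n)} {a b c p u v : Fin n} (hs : IsLabelling H T M s a b c)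
    (hp : partOf T M p = ∅) (E : IsSeeingEdge H T M e u v c)
    (pa : H.Adj p a) (pb : H.Adj p b) : False := by
  have h0 := h.1.empty_notMem_left
  have h0' : e ≠ ∅ := fun he => h.1.empty_notMem_right (he ▸ E.mem)
  have n1 := E.notMem h
  obtain ⟨-, huv1, pu1, pv1, ux1, vx1⟩ := E
  obtain ⟨hsT1, -, ab1, ac1, bc1, pa1, pb1, pc1⟩ := hs
  refine h.false_of_triangles [s] [(u, v, c), (p, a, b)]
    (by simp [*]) (by simp) (by simp [*]) ?_ ?_
  · simp [tripleVerts]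
    repeat' apply And.intro
    all_goals first
      | exact SimpleGraph.Adj.ne (by assumption)
      | exact SimpleGraph.Adj.ne' (by assumption)
      | grind -ext
  · simp [tripleVerts, *]

lemma IsLabelling.not_triangle_of_three_vertices (h : IsMaxTilingTriple H T M I)
    {s₁ s₂ s₃ : Finset (Fin n)} {a₁ b₁ c₁ a₂ b₂ c₂ a₃ b₃ c₃ p₁ p₂ p₃ : Fin n}
    (hs1 : IsLabelling H T M s₁ a₁ b₁ c₁) (hs2 : IsLabelling H T M s₂ a₂ b₂ c₂)
    (hs3 : IsLabelling H T M s₃ a₃ b₃ c₃) (h12 : s₁ ≠ s₂) (h13 : s₁ ≠ s₃) (h23 : s₂ ≠ s₃)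
    (hp1 : partOf T M p₁ ∉ T) (hp2 : partOf T M p₂ ∉ T) (hp3 : partOf T M p₃ ∉ T)
    (hp12 : p₁ ≠ p₂) (hp13 : p₁ ≠ p₃) (hp23 : p₂ ≠ p₃)
    (pa1 : H.Adj p₁ a₁) (pb1 : H.Adj p₁ b₁) (pa2 : H.Adj p₂ a₂) (pb2 : H.Adj p₂ b₂)
    (pa3 : H.Adj p₃ a₃) (pb3 : H.Adj p₃ b₃)
    (c12 : H.Adj c₁ c₂) (c13 : H.Adj c₁ c₃) (c23 : H.Adj c₂ c₃) : False := by
  obtain ⟨hsT1, -, ab1, ac1, bc1, pa1, pb1, pc1⟩ := hs1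
  obtain ⟨hsT2, -, ab2, ac2, bc2, pa2, pb2, pc2⟩ := hs2
  obtain ⟨hsT3, -, ab3, ac3, bc3, pa3, pb3, pc3⟩ := hs3
  refine h.false_of_triangles [s₁, s₂, s₃] [(p₁, a₁, b₁), (p₂, a₂, b₂), (p₃, a₃, b₃), (c₁, c₂, c₃)]
    (by simp [*]) (by simp) (by simp [*]) ?_ ?_
  · simp [tripleVerts]
    repeat' apply And.intro
    all_goals first
      | exact SimpleGraph.Adj.ne (by assumption)
      | exact SimpleGraph.Adj.ne' (by assumption)
      | grind -ext
  · simp [tripleVerts, *]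

lemma IsLabelling.not_path_of_three_vertices (h : IsMaxTilingTriple H T M I)
    {s₁ s₂ s₃ s₄ : Finset (Fin n)} {a₁ b₁ c₁ a₂ b₂ c₂ a₃ b₃ c₃ a₄ b₄ c₄ p₁ p₂ p₃ : Fin n}
    (hs1 : IsLabelling H T M s₁ a₁ b₁ c₁) (hs2 : IsLabelling H T M s₂ a₂ b₂ c₂)
    (hs3 : IsLabelling H T M s₃ a₃ b₃ c₃) (hs4 : IsLabelling H T M s₄ a₄ b₄ c₄)
    (h12 : s₁ ≠ s₂) (h13 : s₁ ≠ s₃) (h23 : s₂ ≠ s₃)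
    (h14 : s₁ ≠ s₄) (h24 : s₂ ≠ s₄) (h34 : s₃ ≠ s₄)
    (hp1 : partOf T M p₁ ∉ T) (hp2 : partOf T M p₂ ∉ T) (hp3 : partOf T M p₃ ∉ T)
    (hp12 : p₁ ≠ p₂) (hp13 : p₁ ≠ p₃) (hp23 : p₂ ≠ p₃)
    (pa1 : H.Adj p₁ a₁) (pb1 : H.Adj p₁ b₁) (pa2 : H.Adj p₂ a₂) (pb2 : H.Adj p₂ b₂)
    (pa3 : H.Adj p₃ a₃) (pb3 : H.Adj p₃ b₃)
    (c12 : H.Adj c₁ c₂) (c1 : H.Adj c₁ a₄) (c2 : H.Adj c₂ a₄)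
    (c3 : H.Adj c₃ b₄) (c3' : H.Adj c₃ c₄) : False := by
  obtain ⟨hsT1, -, ab1, ac1, bc1, pa1, pb1, pc1⟩ := hs1
  obtain ⟨hsT2, -, ab2, ac2, bc2, pa2, pb2, pc2⟩ := hs2
  obtain ⟨hsT3, -, ab3, ac3, bc3, pa3, pb3, pc3⟩ := hs3
  obtain ⟨hsT4, -, ab4, ac4, bc4, pa4, pb4, pc4⟩ := hs4
  refine h.false_of_triangles [s₁, s₂, s₃, s₄]
    [(p₁, a₁, b₁), (p₂, a₂, b₂), (p₃, a₃, b₃), (c₁, c₂, a₄), (c₃, b₄, c₄)]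
    (by simp [*]) (by simp) (by simp [*]) ?_ ?_
  · simp [tripleVerts]
    repeat' apply And.intro
    all_goals first
      | exact SimpleGraph.Adj.ne (by assumption)
      | exact SimpleGraph.Adj.ne' (by assumption)
      | grind -ext
  · simp [tripleVerts, *]

end LocalStructure

section Counting

variable {n : ℕ} {H : SimpleGraph (Fin n)} {T M : Finset (Finset (Fin n))} {I : Finset (Fin n)}

open Classical in
/-- The indicator of adjacency. -/
noncomputable def adjInd (H : SimpleGraph (Fin n)) (x y : Fin n) : ℕ := if H.Adj x y then 1 else 0

/-- The number of neighbours of `x` in `B`. -/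
noncomputable def nbrCount (H : SimpleGraph (Fin n)) (x : Fin n) (B : Finset (Fin n)) : ℕ :=
  ∑ y ∈ B, adjInd H x y

/-- The number of ordered adjacent pairs in `A × B`. -/
noncomputable def crossCount (H : SimpleGraph (Fin n)) (A B : Finset (Fin n)) : ℕ :=
  ∑ x ∈ A, nbrCount H x B

lemma adjInd_le_one (x y : Fin n) : adjInd H x y ≤ 1 := by
  unfold adjInd; split_ifs <;> omega

lemma adj_of_one_le_adjInd {x y : Fin n} (h : 1 ≤ adjInd H x y) : H.Adj x y := by
  by_contra hn
  simp [adjInd, hn] at h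

lemma adjInd_comm (x y : Fin n) : adjInd H x y = adjInd H y x := by
  by_cases h : H.Adj x y
  · simp [adjInd, h, h.symm]
  · have h' : ¬ H.Adj y x := fun h' => h h'.symm
    simp [adjInd, h, h']

lemma adjInd_add_le_one {x y z w : Fin n} (h : H.Adj x y → H.Adj z w → False) :
    adjInd H x y + adjInd H z w ≤ 1 := by
  by_contra hn
  have h1 := adjInd_le_one (H := H) x y
  have h2 := adjInd_le_one (H := H) z w
  exact h (adj_of_one_le_adjInd (by omega)) (adj_of_one_le_adjInd (by omega))

lemma crossCount_comm (A B : Finset (Fin n)) : crossCount H A B = crossCount H B A := by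
  unfold crossCount nbrCount
  rw [Finset.sum_comm]
  exact Finset.sum_congr rfl fun x _ => Finset.sum_congr rfl fun y _ => adjInd_comm _ _

lemma crossCount_le_card_mul {A B : Finset (Fin n)} {c : ℕ} (h : ∀ x ∈ A, nbrCount H x B ≤ c) :
    crossCount H A B ≤ A.card * c := by
  simpa [crossCount] using Finset.sum_le_card_nsmul A _ c h

lemma IsLabelling.sum_eq {s : Finset (Fin n)} {a b c : Fin n} (h : IsLabelling H T M s a b c)
    (f : Fin n → ℕ) : ∑ x ∈ s, f x = f a + f b + f c := by
  rw [h.eq, Finset.sum_insert, Finset.sum_insert, Finset.sum_singleton, add_assoc]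
  · simpa using h.bc.ne
  · simpa using ⟨h.ab.ne, h.ac.ne⟩

lemma IsLabelling.nbrCount_eq {s : Finset (Fin n)} {a b c : Fin n}
    (h : IsLabelling H T M s a b c) (v : Fin n) :
    nbrCount H v s = adjInd H v a + adjInd H v b + adjInd H v c := h.sum_eq _

lemma IsLabelling.crossCount_eq {s : Finset (Fin n)} {a b c : Fin n}
    (h : IsLabelling H T M s a b c) (B : Finset (Fin n)) :
    crossCount H s B = nbrCount H a B + nbrCount H b B + nbrCount H c B := h.sum_eq _

lemma IsLabelling.nbrCount_le_three {s : Finset (Fin n)} {a b c : Fin n}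
    (h : IsLabelling H T M s a b c) (v : Fin n) : nbrCount H v s ≤ 3 := by
  have := adjInd_le_one (H := H) v
  rw [h.nbrCount_eq]
  have h1 := this a
  have h2 := this b
  have h3 := this c
  omega

lemma IsMaxTilingTriple.nbrCount_edge_le_one (h : IsMaxTilingTriple H T M I) {p : Fin n}
    (hp : partOf T M p ∉ T) {e : Finset (Fin n)} (he : e ∈ M) : nbrCount H p e ≤ 1 := by
  obtain ⟨u, v, huv, heq⟩ := Finset.card_eq_two.1 (h.1.2.1 e he).2
  have hu : u ∈ e := by simp [heq]
  have hv : v ∈ e := by simp [heq]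
  have hM : e ∉ T := fun hT => h.1.notMem_right hT he
  have pu := h.1.partOf_eq (Finset.mem_union_right _ he) hu
  have pv := h.1.partOf_eq (Finset.mem_union_right _ he) hv
  have hadj : H.Adj u v := (h.1.2.1 e he).1 (by exact_mod_cast hu) (by exact_mod_cast hv) huv
  have : nbrCount H p e = adjInd H p u + adjInd H p v := by
    rw [nbrCount, heq, Finset.sum_pair huv]
  rw [this]
  exact adjInd_add_le_one fun h1 h2 =>
    h.not_triangle hp (by rwa [pu]) (by rwa [pv]) h1 h2 hadj

lemma IsTilingTriple.partOf_notMem_of_mem_edge (h : IsTilingTriple H T M I)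
    {e : Finset (Fin n)} (he : e ∈ M) {p : Fin n} (hp : p ∈ e) : partOf T M p ∉ T := by
  rw [h.partOf_eq (Finset.mem_union_right _ he) hp]
  exact fun hT => h.notMem_right hT he

lemma IsTilingTriple.partOf_notMem_of_mem_indep (h : IsTilingTriple H T M I)
    {p : Fin n} (hp : p ∈ I) : partOf T M p ∉ T := by
  rw [h.partOf_eq_empty.2 hp]
  exact h.empty_notMem_left

lemma IsCriticalLabelling.nbrCount_le_two (h : IsMaxTilingTriple H T M I) {s : Finset (Fin n)}
    {x y z p : Fin n} (hs : IsCriticalLabelling H T M s x y z) (hp : partOf T M p ∉ T) :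
    nbrCount H p s ≤ 2 := by
  rw [hs.lab.nbrCount_eq]
  have h1 := adjInd_add_le_one (H := H) fun h1 h2 => hs.not_adj h hp h1 h2
  have h2 := adjInd_le_one (H := H) p x
  omega

lemma IsCriticalLabelling.crossCount_le_seven (h : IsMaxTilingTriple H T M I)
    {s₁ s₂ : Finset (Fin n)} {x₁ y₁ z₁ x₂ y₂ z₂ : Fin n}
    (hs1 : IsCriticalLabelling H T M s₁ x₁ y₁ z₁) (hs2 : IsCriticalLabelling H T M s₂ x₂ y₂ z₂)
    (h12 : s₁ ≠ s₂) : crossCount H s₂ s₁ ≤ 7 := by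
  have hy := adjInd_add_le_one (H := H) fun h1 h2 => hs1.not_adj_critical h hs2 h12 h1 h2
  have hz := adjInd_add_le_one (H := H) fun h1 h2 => hs1.not_adj_critical h hs2.swap h12 h1 h2
  rw [hs2.lab.crossCount_eq, hs1.lab.nbrCount_eq, hs1.lab.nbrCount_eq, hs1.lab.nbrCount_eq]
  have e1 := adjInd_le_one (H := H) x₂ x₁
  have e2 := adjInd_le_one (H := H) x₂ y₁
  have e3 := adjInd_le_one (H := H) x₂ z₁
  have e4 := adjInd_le_one (H := H) y₂ x₁
  have e5 := adjInd_le_one (H := H) z₂ x₁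
  omega

lemma IsTilingTriple.crossCount_le_nine (h : IsTilingTriple H T M I) {s s' : Finset (Fin n)}
    (hs : s ∈ T) (hs' : s' ∈ T) : crossCount H s s' ≤ 9 := by
  obtain ⟨a, b, c, hl⟩ := h.exists_isLabelling hs'
  have := crossCount_le_card_mul (H := H) (A := s) (B := s') fun x _ => hl.nbrCount_le_three x
  rw [(h.1 s hs).2] at this
  omega

lemma IsTilingTriple.adj_of_nine_le_crossCount (h : IsTilingTriple H T M I)
    {s s' : Finset (Fin n)} (hs : s ∈ T) (hs' : s' ∈ T) (h9 : 9 ≤ crossCount H s s') :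
    ∀ x ∈ s, ∀ y ∈ s', H.Adj x y := by
  intro x hx y hy
  obtain ⟨b, c, hl⟩ := h.exists_isLabelling_of_mem hs hx
  obtain ⟨b', c', hl'⟩ := h.exists_isLabelling_of_mem hs' hy
  rw [hl.crossCount_eq, hl'.nbrCount_eq] at h9
  have e1 := hl'.nbrCount_le_three b
  have e2 := hl'.nbrCount_le_three c
  have e3 := adjInd_le_one (H := H) x b'
  have e4 := adjInd_le_one (H := H) x c'
  exact adj_of_one_le_adjInd (by omega)

lemma IsTilingTriple.crossCount_self (h : IsTilingTriple H T M I) {s : Finset (Fin n)}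
    (hs : s ∈ T) : crossCount H s s = 6 := by
  obtain ⟨a, b, c, hl⟩ := h.exists_isLabelling hs
  rw [hl.crossCount_eq, hl.nbrCount_eq, hl.nbrCount_eq, hl.nbrCount_eq]
  simp [adjInd, hl.ab, hl.ac, hl.bc, hl.ab.symm, hl.ac.symm, hl.bc.symm]

lemma IsCriticalLabelling.exists_of_eight_le_crossCount (h : IsMaxTilingTriple H T M I)
    {s s' : Finset (Fin n)} {x y z : Fin n}
    (hs : IsCriticalLabelling H T M s x y z) (hs' : s' ∈ T) (h8 : 8 ≤ crossCount H s s') :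
    ∃ a ∈ s', ∃ b ∈ s', a ≠ b ∧ H.Adj a y ∧ H.Adj a z ∧ H.Adj b y ∧ H.Adj b z := by
  obtain ⟨a, b, c, hl⟩ := h.1.exists_isLabelling hs'
  rw [hs.lab.crossCount_eq] at h8
  have e1 := hl.nbrCount_le_three x
  rw [hl.nbrCount_eq y, hl.nbrCount_eq z] at h8
  have ya := adjInd_le_one (H := H) y a
  have yb := adjInd_le_one (H := H) y b
  have yc := adjInd_le_one (H := H) y c
  have za := adjInd_le_one (H := H) z a
  have zb := adjInd_le_one (H := H) z b
  have zc := adjInd_le_one (H := H) z c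
  have adj : ∀ {u v}, 1 ≤ adjInd H u v → H.Adj v u := fun hh => (adj_of_one_le_adjInd hh).symm
  have ha : a ∈ s' := by simp [hl.eq]
  have hb : b ∈ s' := by simp [hl.eq]
  have hc : c ∈ s' := by simp [hl.eq]
  by_cases h1 : adjInd H y a + adjInd H z a ≤ 1
  · exact ⟨b, hb, c, hc, hl.bc.ne, adj (by omega), adj (by omega), adj (by omega), adj (by omega)⟩
  by_cases h2 : adjInd H y b + adjInd H z b ≤ 1
  · exact ⟨a, ha, c, hc, hl.ac.ne, adj (by omega), adj (by omega), adj (by omega), adj (by omega)⟩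
  · exact ⟨a, ha, b, hb, hl.ab.ne, adj (by omega), adj (by omega), adj (by omega), adj (by omega)⟩

lemma IsCriticalLabelling.not_eight_le_crossCount_two (h : IsMaxTilingTriple H T M I)
    {s₁ s₂ s' : Finset (Fin n)} {x₁ y₁ z₁ x₂ y₂ z₂ : Fin n}
    (hs1 : IsCriticalLabelling H T M s₁ x₁ y₁ z₁) (hs2 : IsCriticalLabelling H T M s₂ x₂ y₂ z₂)
    (hs' : s' ∈ T) (h12 : s₁ ≠ s₂) (h1 : s₁ ≠ s') (h2 : s₂ ≠ s')
    (h81 : 8 ≤ crossCount H s₁ s') (h82 : 8 ≤ crossCount H s₂ s') : False := by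
  obtain ⟨a, ha, b, hb, hab, ay, az, bY, bz⟩ := hs1.exists_of_eight_le_crossCount h hs' h81
  obtain ⟨a', ha', b', hb', hab', ay', az', bY', bz'⟩ :=
    hs2.exists_of_eight_le_crossCount h hs' h82
  by_cases haa : a = a'
  · have hne : a ≠ b' := by rw [haa]; exact hab'
    obtain ⟨c, hl⟩ := h.1.exists_isLabelling_of_mem_of_mem hs' ha hb' hne
    exact hs1.not_triangle_three h hs2 hl h12 h1 h2 ay az bY' bz'
  · obtain ⟨c, hl⟩ := h.1.exists_isLabelling_of_mem_of_mem hs' ha ha' haa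
    exact hs1.not_triangle_three h hs2 hl h12 h1 h2 ay az ay' az'

lemma IsCriticalLabelling.crossCount_le_eight (h : IsMaxTilingTriple H T M I)
    {s s' : Finset (Fin n)} {x y z p : Fin n}
    (hs : IsCriticalLabelling H T M s x y z) (hs' : s' ∈ T) (hne : s ≠ s')
    (hp : partOf T M p ∉ T) (hsee : vertexSees H p s') : crossCount H s s' ≤ 8 := by
  by_contra hcon
  have hfull := h.1.adj_of_nine_le_crossCount hs.lab.mem hs' (by omega)
  obtain ⟨a, b, c, hl, pa, pb⟩ := (vertexSees_iff h.1 hs').1 hsee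
  exact hs.not_adj_of_vertex h hl hne hp pa pb
    (hfull y (by simp [hs.lab.eq]) c (by simp [hl.eq])).symm
    (hfull z (by simp [hs.lab.eq]) c (by simp [hl.eq])).symm

/-- `s` is seen by two vertices of `I`, or by an edge of `M` and a vertex of `I`. -/
def IsDoublySeen (H : SimpleGraph (Fin n)) (M : Finset (Finset (Fin n))) (I s : Finset (Fin n)) :
    Prop :=
  (∃ p ∈ I, ∃ q ∈ I, p ≠ q ∧ vertexSees H p s ∧ vertexSees H q s) ∨
    ((∃ e ∈ M, sees H e s) ∧ ∃ p ∈ I, vertexSees H p s)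

lemma IsDoublySeen.exists_vertexSees {s : Finset (Fin n)} (hs : IsDoublySeen H M I s) :
    ∃ p ∈ I, vertexSees H p s := by
  rcases hs with ⟨p, hp, _, _, _, h1, _⟩ | ⟨_, h⟩
  · exact ⟨p, hp, h1⟩
  · exact h

lemma IsDoublySeen.pair_cases {s₁ s₂ : Finset (Fin n)} (h1 : IsDoublySeen H M I s₁)
    (h2 : IsDoublySeen H M I s₂) :
    (∃ p ∈ I, ∃ q ∈ I, p ≠ q ∧ vertexSees H p s₁ ∧ vertexSees H q s₂) ∨
    ((∃ e ∈ M, sees H e s₁) ∧ ∃ p ∈ I, vertexSees H p s₂) ∨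
    ((∃ e ∈ M, sees H e s₂) ∧ ∃ p ∈ I, vertexSees H p s₁) := by
  rcases h1 with ⟨p, hp, q, hq, hpq, hps, hqs⟩ | h1
  · rcases h2 with ⟨p', hp', q', hq', hpq', hps', hqs'⟩ | h2
    · left
      by_cases hh : p = p'
      · exact ⟨p, hp, q', hq', by rw [hh]; exact hpq', hps, hqs'⟩
      · exact ⟨p, hp, p', hp', hh, hps, hps'⟩
    · exact Or.inr (Or.inr ⟨h2.1, p, hp, hps⟩)
  · exact Or.inr (Or.inl ⟨h1.1, h2.exists_vertexSees⟩)

lemma IsMaxTilingTriple.not_full_of_sees (h : IsMaxTilingTriple H T M I) {s₁ s₂ : Finset (Fin n)}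
    (hs1 : s₁ ∈ T) (hs2 : s₂ ∈ T) (hne : s₁ ≠ s₂) (hfull : ∀ x ∈ s₁, ∀ y ∈ s₂, H.Adj x y)
    (h1 : ∃ e ∈ M, sees H e s₁) (h2 : ∃ p ∈ I, vertexSees H p s₂) : False := by
  obtain ⟨e, he, w, hw⟩ := h1
  obtain ⟨p, hp, hps⟩ := h2
  obtain ⟨u, v, E⟩ := h.1.exists_isSeeingEdge he hw
  obtain ⟨b, c, hl⟩ := h.1.exists_isLabelling_of_mem hs1 hw.1
  obtain ⟨a', b', c', hl', pa, pb⟩ := (vertexSees_iff h.1 hs2).1 hps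
  exact hl.not_adj_of_edge_of_vertex h hl' hne (h.1.partOf_eq_empty.2 hp) E pa pb
    (hfull b (by simp [hl.eq]) c' (by simp [hl'.eq])).symm
    (hfull c (by simp [hl.eq]) c' (by simp [hl'.eq])).symm

lemma IsDoublySeen.crossCount_le_eight (h : IsMaxTilingTriple H T M I) {s₁ s₂ : Finset (Fin n)}
    (hs1 : s₁ ∈ T) (hs2 : s₂ ∈ T) (hne : s₁ ≠ s₂) (h1 : IsDoublySeen H M I s₁)
    (h2 : IsDoublySeen H M I s₂) : crossCount H s₁ s₂ ≤ 8 := by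
  by_contra hcon
  have hfull := h.1.adj_of_nine_le_crossCount hs1 hs2 (by omega)
  rcases h1.pair_cases h2 with ⟨p, hp, q, hq, hpq, hps, hqs⟩ | ⟨h3, h4⟩ | ⟨h3, h4⟩
  · obtain ⟨a, b, c, hl, pa, pb⟩ := (vertexSees_iff h.1 hs1).1 hps
    obtain ⟨a', b', c', hl', qa, qb⟩ := (vertexSees_iff h.1 hs2).1 hqs
    exact hl.not_adj_of_two_vertices h hl' hne (h.1.partOf_eq_empty.2 hp)
      (h.1.partOf_eq_empty.2 hq) hpq pa pb qa qb
      (hfull c (by simp [hl.eq]) c' (by simp [hl'.eq]))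
  · exact h.not_full_of_sees hs1 hs2 hne hfull h3 h4
  · exact h.not_full_of_sees hs2 hs1 hne.symm (fun x hx y hy => (hfull y hy x hx).symm) h3 h4

lemma IsMaxTilingTriple.not_full_two_of_sees (h : IsMaxTilingTriple H T M I)
    {s₁ s₂ s₃ : Finset (Fin n)} (hs1 : s₁ ∈ T) (hs2 : s₂ ∈ T) (hs3 : s₃ ∈ T) (h12 : s₁ ≠ s₂)
    (h13 : s₁ ≠ s₃) (h23 : s₂ ≠ s₃) (hfull1 : ∀ x ∈ s₁, ∀ y ∈ s₃, H.Adj x y)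
    (hfull2 : ∀ x ∈ s₂, ∀ y ∈ s₃, H.Adj x y)
    (h1 : ∃ e ∈ M, sees H e s₁) (h2 : ∃ p ∈ I, vertexSees H p s₂) : False := by
  obtain ⟨e, he, w, hw⟩ := h1
  obtain ⟨p, hp, hps⟩ := h2
  obtain ⟨u, v, E⟩ := h.1.exists_isSeeingEdge he hw
  obtain ⟨b, c, hl⟩ := h.1.exists_isLabelling_of_mem hs1 hw.1
  obtain ⟨a', b', c', hl', pa, pb⟩ := (vertexSees_iff h.1 hs2).1 hps
  obtain ⟨a₃, b₃, c₃, hl3⟩ := h.1.exists_isLabelling hs3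
  exact hl.not_adj_three_of_edge_of_vertex h hl' hl3 h12 h13 h23 (h.1.partOf_eq_empty.2 hp) E pa pb
    (hfull1 b (by simp [hl.eq]) a₃ (by simp [hl3.eq]))
    (hfull1 c (by simp [hl.eq]) a₃ (by simp [hl3.eq]))
    (hfull2 c' (by simp [hl'.eq]) b₃ (by simp [hl3.eq]))
    (hfull2 c' (by simp [hl'.eq]) c₃ (by simp [hl3.eq]))

lemma IsDoublySeen.not_nine_le_crossCount_two (h : IsMaxTilingTriple H T M I)
    {s₁ s₂ s₃ : Finset (Fin n)} (hs1 : s₁ ∈ T) (hs2 : s₂ ∈ T) (hs3 : s₃ ∈ T) (h12 : s₁ ≠ s₂)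
    (h13 : s₁ ≠ s₃) (h23 : s₂ ≠ s₃) (h1 : IsDoublySeen H M I s₁) (h2 : IsDoublySeen H M I s₂)
    (h91 : 9 ≤ crossCount H s₁ s₃) (h92 : 9 ≤ crossCount H s₂ s₃) : False := by
  have hfull1 := h.1.adj_of_nine_le_crossCount hs1 hs3 h91
  have hfull2 := h.1.adj_of_nine_le_crossCount hs2 hs3 h92
  rcases h1.pair_cases h2 with ⟨p, hp, q, hq, hpq, hps, hqs⟩ | ⟨h3, h4⟩ | ⟨h3, h4⟩
  · obtain ⟨a, b, c, hl, pa, pb⟩ := (vertexSees_iff h.1 hs1).1 hps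
    obtain ⟨a', b', c', hl', qa, qb⟩ := (vertexSees_iff h.1 hs2).1 hqs
    obtain ⟨a₃, b₃, c₃, hl3⟩ := h.1.exists_isLabelling hs3
    exact hl.not_adj_three_of_two_vertices h hl' hl3 h12 h13 h23 (h.1.partOf_eq_empty.2 hp)
      (h.1.partOf_eq_empty.2 hq) hpq pa pb qa qb
      (hfull1 c (by simp [hl.eq]) a₃ (by simp [hl3.eq]))
      (hfull1 c (by simp [hl.eq]) b₃ (by simp [hl3.eq]))
      (hfull2 c' (by simp [hl'.eq]) c₃ (by simp [hl3.eq]))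
  · exact h.not_full_two_of_sees hs1 hs2 hs3 h12 h13 h23 hfull1 hfull2 h3 h4
  · exact h.not_full_two_of_sees hs2 hs1 hs3 h12.symm h23 h13 hfull2 hfull1 h3 h4

lemma IsDoublySeen.nbrCount_le_two (h : IsMaxTilingTriple H T M I) {s : Finset (Fin n)}
    (hs : s ∈ T) (hd : IsDoublySeen H M I s) {p : Fin n} (hp : p ∈ I) : nbrCount H p s ≤ 2 := by
  by_contra hcon
  have hall : ∀ x ∈ s, H.Adj p x := by
    intro x hx
    obtain ⟨b, c, hl⟩ := h.1.exists_isLabelling_of_mem hs hx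
    rw [hl.nbrCount_eq] at hcon
    have e1 := adjInd_le_one (H := H) p b
    have e2 := adjInd_le_one (H := H) p c
    exact adj_of_one_le_adjInd (by omega)
  have hp0 := h.1.partOf_eq_empty.2 hp
  rcases hd with ⟨p', hp', q', hq', hpq', hps', hqs'⟩ | ⟨⟨e, he, w, hw⟩, -⟩
  · obtain ⟨q, hq, hpq, hqs⟩ : ∃ q ∈ I, p ≠ q ∧ vertexSees H q s := by
      by_cases hh : p = p'
      · exact ⟨q', hq', by rw [hh]; exact hpq', hqs'⟩
      · exact ⟨p', hp', hh, hps'⟩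
    obtain ⟨a, b, c, hl, qa, qb⟩ := (vertexSees_iff h.1 hs).1 hqs
    exact hl.rotate.not_adj_of_vertex h hp0 (h.1.partOf_eq_empty.2 hq) hpq
      (hall b (by simp [hl.eq])) (hall c (by simp [hl.eq])) qa
  · obtain ⟨u, v, E⟩ := h.1.exists_isSeeingEdge he hw
    obtain ⟨b, c, hl⟩ := h.1.exists_isLabelling_of_mem hs hw.1
    exact hl.rotate.not_seeing_of_vertex h hp0 E (hall b (by simp [hl.eq]))
      (hall c (by simp [hl.eq]))

lemma nbrCount_edge_le_one_of_not_seesAt (h : IsTilingTriple H T M I) {e s : Finset (Fin n)}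
    (he : e ∈ M) {w : Fin n} (hw : w ∈ s) (hn : ¬ seesAt H e s w) : nbrCount H w e ≤ 1 := by
  obtain ⟨u, v, huv, heq⟩ := Finset.card_eq_two.1 (h.2.1 e he).2
  have : nbrCount H w e = adjInd H w u + adjInd H w v := by
    rw [nbrCount, heq, Finset.sum_pair huv]
  rw [this]
  refine adjInd_add_le_one fun h1 h2 => hn ⟨hw, fun x hx => ?_⟩
  rw [heq, Finset.mem_insert, Finset.mem_singleton] at hx
  rcases hx with rfl | rfl
  · exact h1.symm
  · exact h2.symm

lemma nbrCount_le_card (x : Fin n) (B : Finset (Fin n)) : nbrCount H x B ≤ B.card := by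
  simpa [nbrCount] using
    Finset.sum_le_card_nsmul B (fun y => adjInd H x y) 1 fun y _ => adjInd_le_one x y

lemma crossCount_le_three_of_not_sees (h : IsTilingTriple H T M I) {e s : Finset (Fin n)}
    (he : e ∈ M) (hs : s ∈ T) (hn : ¬ sees H e s) : crossCount H s e ≤ 3 := by
  have := crossCount_le_card_mul (H := H) (A := s) (B := e) (c := 1) fun w hw =>
    nbrCount_edge_le_one_of_not_seesAt h he hw fun hw' => hn ⟨w, hw'⟩
  rwa [(h.1 s hs).2, mul_one] at this

lemma IsTilingTriple.crossCount_edge_le_six (h : IsTilingTriple H T M I) {e s : Finset (Fin n)}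
    (he : e ∈ M) (hs : s ∈ T) : crossCount H s e ≤ 6 := by
  have := crossCount_le_card_mul (H := H) (A := s) (B := e) fun w _ => nbrCount_le_card w e
  rwa [(h.1 s hs).2, (h.2.1 e he).2] at this

lemma IsDoublySeen.crossCount_edge_le_five (h : IsMaxTilingTriple H T M I)
    {e s : Finset (Fin n)} (he : e ∈ M) (hs : s ∈ T) (hd : IsDoublySeen H M I s) :
    crossCount H s e ≤ 5 := by
  obtain ⟨p, hp, hps⟩ := hd.exists_vertexSees
  obtain ⟨a, b, c, hl, pa, pb⟩ := (vertexSees_iff h.1 hs).1 hps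
  rw [hl.crossCount_eq]
  have e1 := nbrCount_le_card (H := H) a e
  have e2 := nbrCount_le_card (H := H) b e
  rw [(h.1.2.1 e he).2] at e1 e2
  have e3 : nbrCount H c e ≤ 1 := by
    refine nbrCount_edge_le_one_of_not_seesAt h.1 (s := s) he (by simp [hl.eq]) fun hsee => ?_
    obtain ⟨u, v, E⟩ := h.1.exists_isSeeingEdge he hsee
    exact hl.not_seeing_of_vertex h (h.1.partOf_eq_empty.2 hp) E pa pb
  omega

lemma nbrCount_le_one_of_not_vertexSees (h : IsTilingTriple H T M I) {s : Finset (Fin n)}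
    (hs : s ∈ T) {p : Fin n} (hn : ¬ vertexSees H p s) : nbrCount H p s ≤ 1 := by
  obtain ⟨a, b, c, hl⟩ := h.exists_isLabelling hs
  rw [vertexSees_iff h hs] at hn
  push Not at hn
  have h1 := adjInd_add_le_one (H := H) (hn a b c hl)
  have h2 := adjInd_add_le_one (H := H) (hn b c a hl.rotate)
  have h3 := adjInd_add_le_one (H := H) (hn c a b hl.rotate.rotate)
  rw [hl.nbrCount_eq]
  omega

end Counting

section WeightedSums

variable {α : Type*}

lemma sum_le_of_one_exception {S : Finset α} {f : α → ℕ} {B c : ℕ} (hc : ∀ x ∈ S, f x ≤ B + c)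
    (hex : ∀ x ∈ S, ∀ y ∈ S, x ≠ y → B < f x → B < f y → False) :
    ∑ x ∈ S, f x ≤ B * S.card + c := by
  classical
  by_cases h : ∃ x ∈ S, B < f x
  · obtain ⟨x, hx, hBx⟩ := h
    have hle : ∑ y ∈ S.erase x, f y ≤ (S.erase x).card * B :=
      Finset.sum_le_card_nsmul _ _ _ fun y hy => by
        rw [Finset.mem_erase] at hy
        by_contra hlt
        exact hex x hx y hy.2 hy.1.symm hBx (by omega)
    have h1 := Finset.add_sum_erase S f hx
    have h2 := Finset.card_erase_add_one hx
    have h3 := hc x hx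
    rw [← h2]
    nlinarith
  · push Not at h
    have hle := Finset.sum_le_card_nsmul S f B h
    rw [smul_eq_mul, mul_comm] at hle
    exact hle.trans (Nat.le_add_right _ _)

lemma sum_add_le_of_special {S : Finset α} {f : α → ℕ} {B c : ℕ} (hB : ∀ x ∈ S, f x ≤ B)
    {x : α} (hx : x ∈ S) (hc : f x + c ≤ B) : ∑ y ∈ S, f y + c ≤ B * S.card := by
  classical
  have hle : ∑ y ∈ S.erase x, f y ≤ (S.erase x).card * B :=
    Finset.sum_le_card_nsmul _ _ _ fun y hy => hB y (Finset.mem_of_mem_erase hy)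
  have h1 := Finset.add_sum_erase S f hx
  have h2 := Finset.card_erase_add_one hx
  rw [← h2]
  nlinarith

lemma exists_sum_erase_le [DecidableEq α] {Z : Finset α} (hZ : Z.Nonempty) {w : α → α → ℕ}
    (hsymm : ∀ x y, w x y = w y x)
    (hle : ∀ x ∈ Z, ∀ y ∈ Z, w x y ≤ 9)
    (htri : ∀ x ∈ Z, ∀ y ∈ Z, ∀ z ∈ Z, x ≠ y → x ≠ z → y ≠ z →
      9 ≤ w x y → 9 ≤ w x z → 9 ≤ w y z → False)
    (hpath : ∀ p ∈ Z, ∀ q ∈ Z, ∀ r ∈ Z, ∀ s ∈ Z, p ≠ q → p ≠ r → p ≠ s → q ≠ r → q ≠ s → r ≠ s →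
      9 ≤ w p q → 9 ≤ w q r → 9 ≤ w r s → w p r ≤ 6) :
    ∃ x ∈ Z, ∑ y ∈ Z.erase x, w x y ≤ 8 * (Z.erase x).card + 1 := by
  set N : α → Finset α := fun v => {u ∈ Z | u ≠ v ∧ 9 ≤ w v u} with hN
  obtain ⟨y, hy, hmax⟩ := Finset.exists_max_image Z (fun v => (N v).card) hZ
  by_cases hex : ∀ u ∈ Z.erase y, ∀ v ∈ Z.erase y, u ≠ v → 8 < w y u → 8 < w y v → False
  · exact ⟨y, hy, sum_le_of_one_exception
      (fun u hu => hle y hy u (Finset.mem_of_mem_erase hu)) hex⟩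
  push Not at hex
  obtain ⟨x, hx, -, -, -, hxy, -, -⟩ := hex
  rw [Finset.mem_erase] at hx
  refine ⟨x, hx.2, ?_⟩
  by_cases hex : ∀ u ∈ Z.erase x, ∀ v ∈ Z.erase x, u ≠ v → 8 < w x u → 8 < w x v → False
  · exact sum_le_of_one_exception (fun u hu => hle x hx.2 u (Finset.mem_of_mem_erase hu)) hex
  obtain ⟨s, hs, hsx, hsy, hws⟩ : ∃ s ∈ Z, s ≠ x ∧ s ≠ y ∧ 9 ≤ w x s := by
    push Not at hex
    obtain ⟨u, hu, v, hv, huv, h1, h2, -⟩ := hex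
    rw [Finset.mem_erase] at hu hv
    by_cases huy : u = y
    · exact ⟨v, hv.2, hv.1, fun h => huv (huy.trans h.symm), h2⟩
    · exact ⟨u, hu.2, hu.1, huy, h1⟩
  have hpt : ∀ u ∈ Z.erase x, w x u + 2 * (if u ∈ (N y).erase x then 1 else 0) ≤
      8 + (if u ∈ N x then 1 else 0) := by
    intro u hu
    rw [Finset.mem_erase] at hu
    have h9 := hle x hx.2 u hu.2
    by_cases huy : u ∈ (N y).erase x
    · simp only [hN, Finset.mem_erase, Finset.mem_filter] at huy
      obtain ⟨hux, huZ, huy, hwyu⟩ := huy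
      have hus : u ≠ s := by
        rintro rfl
        exact htri x hx.2 y hy u huZ hx.1 hux.symm huy.symm
          (by rw [hsymm]; omega) hws hwyu
      have h6 := hpath u huZ y hy x hx.2 s hs huy hux hus hx.1.symm hsy.symm hsx.symm
        (by rw [hsymm]; exact hwyu) hxy hws
      rw [hsymm] at h6
      split_ifs <;> omega
    · rw [if_neg huy]
      split_ifs with hux
      · omega
      · have : ¬ 9 ≤ w x u := fun h => hux (by simp [hN, hu.1, hu.2, h])
        omega
  have hsum := Finset.sum_le_sum hpt
  rw [Finset.sum_add_distrib, Finset.sum_add_distrib, ← Finset.mul_sum, Finset.sum_const,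
    Finset.sum_boole, Finset.sum_boole] at hsum
  have h1 : (Z.erase x).filter (· ∈ (N y).erase x) = (N y).erase x := by
    ext u; simp only [hN, Finset.mem_erase, Finset.mem_filter]; tauto
  have h2 : (Z.erase x).filter (· ∈ N x) = N x := by
    ext u; simp only [hN, Finset.mem_erase, Finset.mem_filter]; tauto
  rw [h1, h2] at hsum
  have h3 : ((N y).erase x).card + 1 = (N y).card := Finset.card_erase_add_one (by
    simp only [hN, Finset.mem_filter]; exact ⟨hx.2, hx.1, hxy⟩)
  have h4 := hmax x hx.2
  have h5 : 0 < (N y).card := by omega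
  simp only [smul_eq_mul, Nat.cast_id] at hsum
  omega

lemma sum_sum_le_of_no_full_triangle [DecidableEq α] {w : α → α → ℕ}
    (hsymm : ∀ x y, w x y = w y x) (Z : Finset α) (hdiag : ∀ x ∈ Z, w x x = 6)
    (hle : ∀ x ∈ Z, ∀ y ∈ Z, w x y ≤ 9)
    (htri : ∀ x ∈ Z, ∀ y ∈ Z, ∀ z ∈ Z, x ≠ y → x ≠ z → y ≠ z →
      9 ≤ w x y → 9 ≤ w x z → 9 ≤ w y z → False)
    (hpath : ∀ p ∈ Z, ∀ q ∈ Z, ∀ r ∈ Z, ∀ s ∈ Z, p ≠ q → p ≠ r → p ≠ s → q ≠ r → q ≠ s → r ≠ s →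
      9 ≤ w p q → 9 ≤ w q r → 9 ≤ w r s → w p r ≤ 6) :
    ∑ x ∈ Z, ∑ y ∈ Z, w x y ≤ 8 * Z.card ^ 2 := by
  induction hm : Z.card generalizing Z with
  | zero => simp [Finset.card_eq_zero.1 hm]
  | succ m ih =>
    obtain ⟨x, hx, hxs⟩ := exists_sum_erase_le (Finset.card_pos.1 (by omega)) hsymm hle htri hpath
    have hcard : (Z.erase x).card = m := by rw [Finset.card_erase_of_mem hx, hm]; rfl
    have hsub : ∀ {u}, u ∈ Z.erase x → u ∈ Z := Finset.mem_of_mem_erase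
    have hih := ih (Z.erase x) (fun u hu => hdiag u (hsub hu))
      (fun u hu v hv => hle u (hsub hu) v (hsub hv))
      (fun u hu v hv z hz => htri u (hsub hu) v (hsub hv) z (hsub hz))
      (fun u hu v hv z hz s hs => hpath u (hsub hu) v (hsub hv) z (hsub hz) s (hsub hs)) hcard
    have h1 : ∀ u, ∑ v ∈ Z, w u v = w u x + ∑ v ∈ Z.erase x, w u v := fun u =>
      (Finset.add_sum_erase Z _ hx).symm
    rw [← Finset.add_sum_erase Z _ hx, Finset.sum_congr rfl fun u _ => h1 u,
      Finset.sum_add_distrib, h1, hdiag x hx, Finset.sum_congr rfl fun u _ => hsymm u x]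
    rw [hcard] at hxs
    nlinarith

end WeightedSums

section FamilyBounds

variable {n : ℕ} {H : SimpleGraph (Fin n)} {T M : Finset (Finset (Fin n))} {I : Finset (Fin n)}

/-- At least three vertices outside the triangles of `T` see `s`. -/
def IsTriplySeen (H : SimpleGraph (Fin n)) (T M : Finset (Finset (Fin n)))
    (s : Finset (Fin n)) : Prop :=
  ∃ P : Finset (Fin n), P.card = 3 ∧ ∀ p ∈ P, partOf T M p ∉ T ∧ vertexSees H p s

lemma exists_distinct_representatives {P₁ P₂ P₃ : Finset (Fin n)} (h1 : P₁.card = 3)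
    (h2 : P₂.card = 3) (h3 : P₃.card = 3) :
    ∃ p₁ ∈ P₁, ∃ p₂ ∈ P₂, ∃ p₃ ∈ P₃, p₁ ≠ p₂ ∧ p₁ ≠ p₃ ∧ p₂ ≠ p₃ := by
  obtain ⟨p₁, hp1⟩ := Finset.card_pos.1 (show 0 < P₁.card by omega)
  obtain ⟨p₂, hp2, h12⟩ := Finset.exists_mem_ne (show 1 < P₂.card by omega) p₁
  obtain ⟨p₃, hp3⟩ : (P₃ \ {p₁, p₂}).Nonempty := by
    rw [← Finset.card_pos]
    have := Finset.le_card_sdiff {p₁, p₂} P₃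
    have h4 : ({p₁, p₂} : Finset (Fin n)).card ≤ 2 := Finset.card_le_two
    omega
  simp only [Finset.mem_sdiff, Finset.mem_insert, Finset.mem_singleton, not_or] at hp3
  exact ⟨p₁, hp1, p₂, hp2, p₃, hp3.1, h12.symm, Ne.symm hp3.2.1, Ne.symm hp3.2.2⟩

/-- Distinct vertices outside the triangles of `T` see three triply seen triangles. -/
lemma IsTriplySeen.exists_labellings (h : IsTilingTriple H T M I)
    {s₁ s₂ s₃ : Finset (Fin n)} (hs1 : s₁ ∈ T) (hs2 : s₂ ∈ T) (hs3 : s₃ ∈ T)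
    (h1 : IsTriplySeen H T M s₁) (h2 : IsTriplySeen H T M s₂) (h3 : IsTriplySeen H T M s₃) :
    ∃ p₁ p₂ p₃, (partOf T M p₁ ∉ T ∧ partOf T M p₂ ∉ T ∧ partOf T M p₃ ∉ T) ∧
      (p₁ ≠ p₂ ∧ p₁ ≠ p₃ ∧ p₂ ≠ p₃) ∧
      (∃ a b c, IsLabelling H T M s₁ a b c ∧ H.Adj p₁ a ∧ H.Adj p₁ b) ∧
      (∃ a b c, IsLabelling H T M s₂ a b c ∧ H.Adj p₂ a ∧ H.Adj p₂ b) ∧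
      (∃ a b c, IsLabelling H T M s₃ a b c ∧ H.Adj p₃ a ∧ H.Adj p₃ b) := by
  obtain ⟨P₁, hc1, hP1⟩ := h1
  obtain ⟨P₂, hc2, hP2⟩ := h2
  obtain ⟨P₃, hc3, hP3⟩ := h3
  obtain ⟨p₁, hp1, p₂, hp2, p₃, hp3, hne⟩ := exists_distinct_representatives hc1 hc2 hc3
  exact ⟨p₁, p₂, p₃, ⟨(hP1 p₁ hp1).1, (hP2 p₂ hp2).1, (hP3 p₃ hp3).1⟩, hne,
    (vertexSees_iff h hs1).1 (hP1 p₁ hp1).2, (vertexSees_iff h hs2).1 (hP2 p₂ hp2).2,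
    (vertexSees_iff h hs3).1 (hP3 p₃ hp3).2⟩

lemma IsTriplySeen.not_full_triangle (h : IsMaxTilingTriple H T M I)
    {s₁ s₂ s₃ : Finset (Fin n)} (hs1 : s₁ ∈ T) (hs2 : s₂ ∈ T) (hs3 : s₃ ∈ T)
    (h1 : IsTriplySeen H T M s₁) (h2 : IsTriplySeen H T M s₂) (h3 : IsTriplySeen H T M s₃)
    (h12 : s₁ ≠ s₂) (h13 : s₁ ≠ s₃) (h23 : s₂ ≠ s₃) (f12 : 9 ≤ crossCount H s₁ s₂)
    (f13 : 9 ≤ crossCount H s₁ s₃) (f23 : 9 ≤ crossCount H s₂ s₃) : False := by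
  obtain ⟨p₁, p₂, p₃, ⟨hp1, hp2, hp3⟩, ⟨hp12, hp13, hp23⟩, ⟨a₁, b₁, c₁, l1, pa1, pb1⟩,
    ⟨a₂, b₂, c₂, l2, pa2, pb2⟩, ⟨a₃, b₃, c₃, l3, pa3, pb3⟩⟩ :=
    exists_labellings h.1 hs1 hs2 hs3 h1 h2 h3
  have m1 : c₁ ∈ s₁ := by simp [l1.eq]
  have m2 : c₂ ∈ s₂ := by simp [l2.eq]
  have m3 : c₃ ∈ s₃ := by simp [l3.eq]
  exact l1.not_triangle_of_three_vertices h l2 l3 h12 h13 h23 hp1 hp2 hp3 hp12 hp13 hp23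
    pa1 pb1 pa2 pb2 pa3 pb3 (h.1.adj_of_nine_le_crossCount hs1 hs2 f12 _ m1 _ m2)
    (h.1.adj_of_nine_le_crossCount hs1 hs3 f13 _ m1 _ m3)
    (h.1.adj_of_nine_le_crossCount hs2 hs3 f23 _ m2 _ m3)

lemma IsTriplySeen.crossCount_le_six_of_path (h : IsMaxTilingTriple H T M I)
    {s₁ s₂ s₃ s₄ : Finset (Fin n)} (hs1 : s₁ ∈ T) (hs2 : s₂ ∈ T) (hs3 : s₃ ∈ T) (hs4 : s₄ ∈ T)
    (h1 : IsTriplySeen H T M s₁) (h2 : IsTriplySeen H T M s₂) (h3 : IsTriplySeen H T M s₃)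
    (h12 : s₁ ≠ s₂) (h13 : s₁ ≠ s₃) (h23 : s₂ ≠ s₃) (h14 : s₁ ≠ s₄) (h24 : s₂ ≠ s₄)
    (h34 : s₃ ≠ s₄) (f12 : 9 ≤ crossCount H s₁ s₂) (f24 : 9 ≤ crossCount H s₂ s₄)
    (f43 : 9 ≤ crossCount H s₄ s₃) : crossCount H s₁ s₄ ≤ 6 := by
  obtain ⟨p₁, p₂, p₃, ⟨hp1, hp2, hp3⟩, ⟨hp12, hp13, hp23⟩, ⟨a₁, b₁, c₁, l1, pa1, pb1⟩,
    ⟨a₂, b₂, c₂, l2, pa2, pb2⟩, ⟨a₃, b₃, c₃, l3, pa3, pb3⟩⟩ :=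
    exists_labellings h.1 hs1 hs2 hs3 h1 h2 h3
  have m1 : c₁ ∈ s₁ := by simp [l1.eq]
  have m2 : c₂ ∈ s₂ := by simp [l2.eq]
  have m3 : c₃ ∈ s₃ := by simp [l3.eq]
  have hz : nbrCount H c₁ s₄ = 0 := by
    refine Finset.sum_eq_zero fun a ha => ?_
    rw [adjInd, if_neg]
    intro hadj
    obtain ⟨b, c, l4⟩ := h.1.exists_isLabelling_of_mem hs4 ha
    exact l1.not_path_of_three_vertices h l2 l3 l4 h12 h13 h23 h14 h24 h34 hp1 hp2 hp3
      hp12 hp13 hp23 pa1 pb1 pa2 pb2 pa3 pb3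
      (h.1.adj_of_nine_le_crossCount hs1 hs2 f12 _ m1 _ m2) hadj
      (h.1.adj_of_nine_le_crossCount hs2 hs4 f24 _ m2 _ ha)
      (h.1.adj_of_nine_le_crossCount hs4 hs3 f43 b (by simp [l4.eq]) _ m3).symm
      (h.1.adj_of_nine_le_crossCount hs4 hs3 f43 c (by simp [l4.eq]) _ m3).symm
  obtain ⟨a, b, c, l4⟩ := h.1.exists_isLabelling hs4
  rw [l1.crossCount_eq, hz]
  have e1 := l4.nbrCount_le_three a₁
  have e2 := l4.nbrCount_le_three b₁
  omega

lemma crossCount_biUnion_left {F : Finset (Finset (Fin n))}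
    (hF : (F : Set (Finset (Fin n))).Pairwise fun s₁ s₂ => Disjoint s₁ s₂)
    (B : Finset (Fin n)) : crossCount H (F.biUnion id) B = ∑ s ∈ F, crossCount H s B :=
  Finset.sum_biUnion hF

lemma crossCount_union_left {A A' : Finset (Fin n)} (hd : Disjoint A A') (B : Finset (Fin n)) :
    crossCount H (A ∪ A') B = crossCount H A B + crossCount H A' B :=
  Finset.sum_union hd

lemma crossCount_union_right {A A' : Finset (Fin n)} (hd : Disjoint A A') (B : Finset (Fin n)) :
    crossCount H B (A ∪ A') = crossCount H B A + crossCount H B A' := by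
  rw [crossCount_comm, crossCount_union_left hd, crossCount_comm A, crossCount_comm A']

lemma crossCount_biUnion_right {F : Finset (Finset (Fin n))}
    (hF : (F : Set (Finset (Fin n))).Pairwise fun s₁ s₂ => Disjoint s₁ s₂)
    (B : Finset (Fin n)) : crossCount H B (F.biUnion id) = ∑ s ∈ F, crossCount H B s := by
  rw [crossCount_comm, crossCount_biUnion_left hF]
  exact Finset.sum_congr rfl fun s _ => crossCount_comm s B

lemma crossCount_biUnion_biUnion {F G : Finset (Finset (Fin n))}
    (hF : (F : Set (Finset (Fin n))).Pairwise fun s₁ s₂ => Disjoint s₁ s₂)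
    (hG : (G : Set (Finset (Fin n))).Pairwise fun s₁ s₂ => Disjoint s₁ s₂) :
    crossCount H (F.biUnion id) (G.biUnion id) = ∑ s ∈ F, ∑ s' ∈ G, crossCount H s s' := by
  rw [crossCount_biUnion_left hF]
  exact Finset.sum_congr rfl fun s _ => crossCount_biUnion_right hG s

/-- Twice the number of edges is the number of ordered adjacent pairs. -/
lemma two_mul_ncard_edgeSet : 2 * H.edgeSet.ncard = crossCount H univ univ := by
  classical
  have h1 := H.sum_degrees_eq_twice_card_edges
  rw [← Set.ncard_coe_finset, SimpleGraph.coe_edgeFinset] at h1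
  rw [← h1]
  refine Finset.sum_congr rfl fun x _ => ?_
  unfold nbrCount adjInd
  rw [Finset.sum_boole, Nat.cast_id, ← SimpleGraph.card_neighborFinset_eq_degree]
  congr 1
  ext y
  simp

lemma IsTilingTriple.pairwise_left (h : IsTilingTriple H T M I) :
    (T : Set (Finset (Fin n))).Pairwise fun s₁ s₂ => Disjoint s₁ s₂ :=
  h.2.2.2.1.mono (by simp)

lemma IsTilingTriple.pairwise_right (h : IsTilingTriple H T M I) :
    (M : Set (Finset (Fin n))).Pairwise fun s₁ s₂ => Disjoint s₁ s₂ :=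
  h.2.2.2.1.mono (by simp)

lemma IsTilingTriple.disjoint_biUnion (h : IsTilingTriple H T M I) :
    Disjoint (T.biUnion id) (M.biUnion id) := by
  simp only [Finset.disjoint_biUnion_left, Finset.disjoint_biUnion_right, id]
  intro e he s hs
  exact h.2.2.2.1 (by simp [hs]) (by simp [he]) fun hse => h.notMem_right hs (hse ▸ he)

lemma IsTilingTriple.disjoint_indep (h : IsTilingTriple H T M I) :
    Disjoint (T.biUnion id) I ∧ Disjoint (M.biUnion id) I := by
  have := h.2.2.2.2.1
  rwa [Finset.union_biUnion, Finset.disjoint_union_left] at this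

lemma IsTilingTriple.univ_eq (h : IsTilingTriple H T M I) :
    (univ : Finset (Fin n)) = T.biUnion id ∪ (M.biUnion id ∪ I) := by
  rw [← Finset.union_assoc, ← Finset.union_biUnion, h.2.2.2.2.2]

lemma IsTilingTriple.disjoint_outside (h : IsTilingTriple H T M I) :
    Disjoint (T.biUnion id) (M.biUnion id ∪ I) :=
  Finset.disjoint_union_right.2 ⟨h.disjoint_biUnion, h.disjoint_indep.1⟩

lemma IsTilingTriple.card_biUnion_left (h : IsTilingTriple H T M I) :
    (T.biUnion id).card = 3 * T.card := by
  rw [Finset.card_biUnion (t := id) fun s hs t ht => h.pairwise_left hs ht,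
    Finset.sum_const_nat (f := fun s => #(id s)) fun s hs => (h.1 s hs).2, mul_comm]

lemma IsTilingTriple.card_biUnion_right (h : IsTilingTriple H T M I) :
    (M.biUnion id).card = 2 * M.card := by
  rw [Finset.card_biUnion (t := id) fun s hs t ht => h.pairwise_right hs ht,
    Finset.sum_const_nat (f := fun s => #(id s)) fun s hs => (h.2.1 s hs).2, mul_comm]

lemma IsTilingTriple.card_eq (h : IsTilingTriple H T M I) :
    n = 3 * T.card + 2 * M.card + I.card := by
  have h1 := congrArg Finset.card h.univ_eq
  rw [Finset.card_union_of_disjoint h.disjoint_outside,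
    Finset.card_union_of_disjoint h.disjoint_indep.2, h.card_biUnion_left,
    h.card_biUnion_right, Finset.card_univ, Fintype.card_fin] at h1
  omega

lemma IsTilingTriple.partOf_notMem_of_mem_outside (h : IsTilingTriple H T M I) {p : Fin n}
    (hp : p ∈ M.biUnion id ∪ I) : partOf T M p ∉ T := by
  rcases Finset.mem_union.1 hp with hp | hp
  · obtain ⟨e, he, hpe⟩ := Finset.mem_biUnion.1 hp
    exact h.partOf_notMem_of_mem_edge he hpe
  · exact h.partOf_notMem_of_mem_indep hp

/-- The decomposition of the edge count of `H` along a tiling triple. -/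
lemma IsTilingTriple.two_mul_ncard_edgeSet_eq (h : IsTilingTriple H T M I) :
    2 * H.edgeSet.ncard = ∑ s ∈ T, ∑ s' ∈ T, crossCount H s s' +
      2 * ∑ s ∈ T, crossCount H s (M.biUnion id ∪ I) +
      crossCount H (M.biUnion id ∪ I) (M.biUnion id ∪ I) := by
  rw [two_mul_ncard_edgeSet, h.univ_eq, crossCount_union_left h.disjoint_outside,
    crossCount_union_right h.disjoint_outside, crossCount_union_right h.disjoint_outside,
    crossCount_biUnion_biUnion h.pairwise_left h.pairwise_left,
    crossCount_comm (M.biUnion id ∪ I) (T.biUnion id), crossCount_biUnion_left h.pairwise_left]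
  ring

lemma IsMaxTilingTriple.crossCount_outside_le (h : IsMaxTilingTriple H T M I) :
    crossCount H (M.biUnion id ∪ I) (M.biUnion id ∪ I) ≤
      2 * M.card ^ 2 + 2 * (M.card * I.card) := by
  have hpe : ∀ p ∈ M.biUnion id ∪ I, nbrCount H p (M.biUnion id) ≤ M.card := by
    intro p hp
    have hsum : nbrCount H p (M.biUnion id) = ∑ e ∈ M, nbrCount H p e :=
      Finset.sum_biUnion fun s hs t ht hst => h.1.pairwise_right hs ht hst
    rw [hsum]
    simpa using Finset.sum_le_card_nsmul M _ 1 fun e he =>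
      h.nbrCount_edge_le_one (h.1.partOf_notMem_of_mem_outside hp) he
  have hMM := crossCount_le_card_mul fun p hp => hpe p (Finset.mem_union_left I hp)
  have hIM := crossCount_le_card_mul fun p hp => hpe p (Finset.mem_union_right _ hp)
  have hII : crossCount H I I = 0 :=
    Finset.sum_eq_zero fun x hx => Finset.sum_eq_zero fun y hy => by
      rw [adjInd, if_neg (h.1.2.2.1 x hx y hy)]
  rw [h.1.card_biUnion_right] at hMM
  rw [crossCount_union_left h.1.disjoint_indep.2, crossCount_union_right h.1.disjoint_indep.2,
    crossCount_union_right h.1.disjoint_indep.2, hII, crossCount_comm (M.biUnion id) I]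
  nlinarith

end FamilyBounds

section ClassBounds

variable {n : ℕ} {H : SimpleGraph (Fin n)} {T M : Finset (Finset (Fin n))} {I : Finset (Fin n)}

lemma IsTilingTriple.crossCount_outside_eq (h : IsTilingTriple H T M I) (s : Finset (Fin n)) :
    crossCount H s (M.biUnion id ∪ I) = ∑ e ∈ M, crossCount H s e + ∑ p ∈ I, nbrCount H p s := by
  rw [crossCount_union_right h.disjoint_indep.2, crossCount_biUnion_right h.pairwise_right,
    crossCount_comm s I]
  rfl

lemma IsTilingTriple.card_outside (h : IsTilingTriple H T M I) :
    (M.biUnion id ∪ I).card = 2 * M.card + I.card := by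
  rw [Finset.card_union_of_disjoint h.disjoint_indep.2, h.card_biUnion_right]

lemma IsCriticalLabelling.crossCount_outside_le (h : IsMaxTilingTriple H T M I)
    {s : Finset (Fin n)} {x y z : Fin n} (hs : IsCriticalLabelling H T M s x y z) :
    crossCount H s (M.biUnion id ∪ I) ≤ 4 * M.card + 2 * I.card := by
  have := crossCount_le_card_mul fun p hp =>
    hs.nbrCount_le_two h (h.1.partOf_notMem_of_mem_outside hp)
  rw [h.1.card_outside] at this
  rw [crossCount_comm]
  omega

lemma IsMaxTilingTriple.sum_crossCount_edge_le {c : ℕ} (h : IsMaxTilingTriple H T M I)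
    {s : Finset (Fin n)} (hs : s ∈ T)
    (hns : ∀ e₁ ∈ M, ∀ e₂ ∈ M, e₁ ≠ e₂ → sees H e₁ s → sees H e₂ s → False)
    (hc : ∀ e ∈ M, crossCount H s e ≤ 3 + c) :
    ∑ e ∈ M, crossCount H s e ≤ 3 * M.card + c := by
  have hsee : ∀ e ∈ M, 3 < crossCount H s e → sees H e s := fun e he h3 => by
    by_contra hn
    have := crossCount_le_three_of_not_sees h.1 he hs hn
    omega
  exact sum_le_of_one_exception hc fun e₁ h1 e₂ h2 hne h31 h32 =>
    hns e₁ h1 e₂ h2 hne (hsee e₁ h1 h31) (hsee e₂ h2 h32)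

lemma IsDoublySeen.crossCount_outside_le (h : IsMaxTilingTriple H T M I)
    {s : Finset (Fin n)} (hs : s ∈ T) (hd : IsDoublySeen H M I s)
    (hns : ∀ e₁ ∈ M, ∀ e₂ ∈ M, e₁ ≠ e₂ → sees H e₁ s → sees H e₂ s → False) :
    crossCount H s (M.biUnion id ∪ I) ≤ 3 * M.card + 2 + 2 * I.card := by
  have h1 := h.sum_crossCount_edge_le hs hns (c := 2) fun e he => hd.crossCount_edge_le_five h he hs
  have h2 := Finset.sum_le_card_nsmul I (fun p => nbrCount H p s) 2 fun p hp =>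
    hd.nbrCount_le_two h hs hp
  rw [smul_eq_mul] at h2
  rw [h.1.crossCount_outside_eq]
  omega

lemma IsMaxTilingTriple.crossCount_outside_le_of_not_isDoublySeen (h : IsMaxTilingTriple H T M I)
    {s : Finset (Fin n)} (hs : s ∈ T) (hd : ¬ IsDoublySeen H M I s)
    (hns : ∀ e₁ ∈ M, ∀ e₂ ∈ M, e₁ ≠ e₂ → sees H e₁ s → sees H e₂ s → False) :
    crossCount H s (M.biUnion id ∪ I) ≤ 3 * M.card + 3 + (I.card + 2) := by
  obtain ⟨a, b, c, hl⟩ := h.1.exists_isLabelling hs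
  have h1 := h.sum_crossCount_edge_le hs hns (c := 3) fun e he => h.1.crossCount_edge_le_six he hs
  have hsee : ∀ p, 1 < nbrCount H p s → vertexSees H p s := fun p h1 => by
    by_contra hn
    have := nbrCount_le_one_of_not_vertexSees h.1 hs hn
    omega
  have h2 := sum_le_of_one_exception (S := I) (f := fun p => nbrCount H p s) (B := 1) (c := 2)
    (fun p _ => hl.nbrCount_le_three p) fun p hp q hq hpq h1 h2 =>
      hd (Or.inl ⟨p, hp, q, hq, hpq, hsee p h1, hsee q h2⟩)
  rw [h.1.crossCount_outside_eq]
  omega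

lemma IsMaxTilingTriple.crossCount_outside_le_of_not_isTriplySeen (h : IsMaxTilingTriple H T M I)
    {s : Finset (Fin n)} (hs : s ∈ T) (ht : ¬ IsTriplySeen H T M s) :
    crossCount H s (M.biUnion id ∪ I) ≤ 2 * M.card + I.card + 4 := by
  classical
  obtain ⟨a, b, c, hl⟩ := h.1.exists_isLabelling hs
  set W := M.biUnion id ∪ I with hW
  have hcard : (W.filter fun p => vertexSees H p s).card ≤ 2 := by
    by_contra hcon
    obtain ⟨P, hP, hP3⟩ := Finset.exists_subset_card_eq
      (show 3 ≤ (W.filter fun p => vertexSees H p s).card by omega)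
    refine ht ⟨P, hP3, fun p hp => ?_⟩
    have := Finset.mem_filter.1 (hP hp)
    exact ⟨h.1.partOf_notMem_of_mem_outside this.1, this.2⟩
  have hpt : ∀ p ∈ W, nbrCount H p s ≤ 1 + 2 * (if vertexSees H p s then 1 else 0) := by
    intro p _
    split_ifs with hp
    · exact hl.nbrCount_le_three p
    · exact nbrCount_le_one_of_not_vertexSees h.1 hs hp
  have hsum := Finset.sum_le_sum hpt
  rw [Finset.sum_add_distrib, ← Finset.mul_sum, Finset.sum_boole, Finset.sum_const, smul_eq_mul,
    hW, h.1.card_outside, ← hW, Nat.cast_id] at hsum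
  rw [crossCount_comm]
  unfold crossCount
  omega

/-- The number of ordered adjacent pairs between members of `P` and members of `R`. -/
noncomputable def famCount (H : SimpleGraph (Fin n)) (P R : Finset (Finset (Fin n))) : ℕ :=
  ∑ s ∈ P, ∑ s' ∈ R, crossCount H s s'

lemma famCount_comm (P R : Finset (Finset (Fin n))) : famCount H P R = famCount H R P := by
  unfold famCount
  rw [Finset.sum_comm]
  exact Finset.sum_congr rfl fun s _ => Finset.sum_congr rfl fun s' _ => crossCount_comm _ _

lemma famCount_union_left {P P' : Finset (Finset (Fin n))} (hd : Disjoint P P')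
    (R : Finset (Finset (Fin n))) :
    famCount H (P ∪ P') R = famCount H P R + famCount H P' R := Finset.sum_union hd

lemma famCount_union_self {P P' : Finset (Finset (Fin n))} (hd : Disjoint P P') :
    famCount H (P ∪ P') (P ∪ P') = famCount H P P + 2 * famCount H P P' + famCount H P' P' := by
  rw [famCount_union_left hd, famCount_comm P, famCount_union_left hd, famCount_comm P' (P ∪ P'),
    famCount_union_left hd, famCount_comm P' P]
  ring

lemma famCount_le_of_forall {P R : Finset (Finset (Fin n))} {c : ℕ}
    (hc : ∀ s' ∈ R, ∑ s ∈ P, crossCount H s s' ≤ c) : famCount H P R ≤ c * R.card := by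
  rw [famCount_comm, mul_comm]
  refine Finset.sum_le_card_nsmul R _ c fun s' hs' => ?_
  simpa only [crossCount_comm s'] using hc s' hs'

lemma IsTilingTriple.famCount_self_add_le (h : IsTilingTriple H T M I)
    {P : Finset (Finset (Fin n))} (hP : P ⊆ T) {c : ℕ}
    (hc : ∀ s ∈ P, ∀ s' ∈ P, s ≠ s' → crossCount H s s' ≤ 6 + c) :
    famCount H P P + c * P.card ≤ (6 + c) * P.card ^ 2 := by
  have hrow : ∀ s ∈ P, ∑ s' ∈ P, crossCount H s s' + c ≤ (6 + c) * P.card := fun s hs =>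
    sum_add_le_of_special (fun s' hs' => by
      by_cases hss : s = s'
      · rw [← hss, h.crossCount_self (hP hs)]; omega
      · exact hc s hs s' hs' hss) hs (by rw [h.crossCount_self (hP hs)])
  have := Finset.sum_le_card_nsmul P _ _ hrow
  rw [Finset.sum_add_distrib, Finset.sum_const, smul_eq_mul, smul_eq_mul] at this
  unfold famCount
  nlinarith

end ClassBounds

section EdgeBound

variable {n : ℕ} {H : SimpleGraph (Fin n)} {T M : Finset (Finset (Fin n))} {I : Finset (Fin n)}

lemma famCount_critical_le (h : IsMaxTilingTriple H T M I) {P R : Finset (Finset (Fin n))} {c : ℕ}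
    (hP : ∀ s ∈ P, ∃ x y z, IsCriticalLabelling H T M s x y z) (hR : R ⊆ T) (hd : Disjoint P R)
    (hc : ∀ s ∈ P, ∀ s' ∈ R, crossCount H s s' ≤ 7 + c) :
    famCount H P R ≤ (7 * P.card + c) * R.card := by
  refine famCount_le_of_forall fun s' hs' => sum_le_of_one_exception (fun s hs => hc s hs s' hs') ?_
  intro s₁ h1 s₂ h2 h12 h71 h72
  obtain ⟨x₁, y₁, z₁, l1⟩ := hP s₁ h1
  obtain ⟨x₂, y₂, z₂, l2⟩ := hP s₂ h2
  exact l1.not_eight_le_crossCount_two h l2 (hR hs') h12 (Finset.disjoint_iff_ne.1 hd _ h1 _ hs')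
    (Finset.disjoint_iff_ne.1 hd _ h2 _ hs') h71 h72

lemma famCount_doublySeen_le (h : IsMaxTilingTriple H T M I) {P R : Finset (Finset (Fin n))}
    (hP : P ⊆ T) (hPd : ∀ s ∈ P, IsDoublySeen H M I s) (hR : R ⊆ T) (hd : Disjoint P R) :
    famCount H P R ≤ (8 * P.card + 1) * R.card := by
  refine famCount_le_of_forall fun s' hs' =>
    sum_le_of_one_exception (fun s hs => h.1.crossCount_le_nine (hP hs) (hR hs')) ?_
  intro s₁ h1 s₂ h2 h12 h71 h72
  exact (hPd s₁ h1).not_nine_le_crossCount_two h (hP h1) (hP h2) (hR hs') h12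
    (Finset.disjoint_iff_ne.1 hd _ h1 _ hs') (Finset.disjoint_iff_ne.1 hd _ h2 _ hs')
    (hPd s₂ h2) h71 h72

lemma famCount_triplySeen_le (h : IsMaxTilingTriple H T M I) {P : Finset (Finset (Fin n))}
    (hP : P ⊆ T) (hPt : ∀ s ∈ P, IsTriplySeen H T M s) :
    famCount H P P ≤ 8 * P.card ^ 2 := by
  refine sum_sum_le_of_no_full_triangle crossCount_comm P (fun s hs => h.1.crossCount_self (hP hs))
    (fun s hs s' hs' => h.1.crossCount_le_nine (hP hs) (hP hs')) ?_ ?_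
  · intro x hx y hy z hz hxy hxz hyz
    exact (hPt x hx).not_full_triangle h (hP hx) (hP hy) (hP hz) (hPt y hy) (hPt z hz) hxy hxz hyz
  · intro x hx y hy r hr s hs hxy hxr hxs hyr hys hrs
    exact (hPt x hx).crossCount_le_six_of_path h (hP hx) (hP hy) (hP hs) (hP hr) (hPt y hy)
      (hPt s hs) hxy hxs hys hxr hyr hrs.symm

lemma famCount_le_nine (h : IsTilingTriple H T M I) {P R : Finset (Finset (Fin n))}
    (hP : P ⊆ T) (hR : R ⊆ T) : famCount H P R ≤ 9 * P.card * R.card :=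
  famCount_le_of_forall fun s' hs' => by
    have := Finset.sum_le_card_nsmul P (fun s => crossCount H s s') 9 fun s hs =>
      h.crossCount_le_nine (hP hs) (hR hs')
    rwa [smul_eq_mul, mul_comm] at this

lemma IsMaxTilingTriple.two_mul_ncard_edgeSet_le (h : IsMaxTilingTriple H T M I)
    {T₁ : Finset (Finset (Fin n))}
    (hT₁ : ∀ s, s ∈ T₁ ↔ s ∈ T ∧ ∃ e₁ ∈ M, ∃ e₂ ∈ M, e₁ ≠ e₂ ∧ sees H e₁ s ∧ sees H e₂ s) :
    ∃ a z q X : ℕ, T.card = T₁.card + a + z + q ∧ X ≤ 8 * T₁.card * a ∧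
      X ≤ (7 * T₁.card + 1) * a ∧
      2 * H.edgeSet.ncard + T₁.card + 2 * a + 3 * q ≤
        7 * T₁.card ^ 2 + 8 * a ^ 2 + 8 * z ^ 2 + 9 * q ^ 2 + 18 * z * q + 2 * X +
        2 * ((7 * T₁.card + 2) * (z + q)) + 2 * ((8 * a + 1) * (z + q)) +
        2 * (T₁.card * (4 * M.card + 2 * I.card) + a * (3 * M.card + 2 + 2 * I.card) +
          z * (3 * M.card + 3 + (I.card + 2)) + q * (2 * M.card + I.card + 4)) +
        (2 * M.card ^ 2 + 2 * (M.card * I.card)) := by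
  classical
  set A := (T \ T₁).filter fun s => IsDoublySeen H M I s with hA
  set Z := (T \ T₁).filter fun s => ¬ IsDoublySeen H M I s ∧ IsTriplySeen H T M s with hZ
  set Q := (T \ T₁).filter fun s => ¬ IsDoublySeen H M I s ∧ ¬ IsTriplySeen H T M s with hQ
  have hT₁T : T₁ ⊆ T := fun s hs => ((hT₁ s).1 hs).1
  have hAT : A ⊆ T := (Finset.filter_subset _ _).trans Finset.sdiff_subset
  have hZT : Z ⊆ T := (Finset.filter_subset _ _).trans Finset.sdiff_subset
  have hQT : Q ⊆ T := (Finset.filter_subset _ _).trans Finset.sdiff_subset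
  have hZQT : Z ∪ Q ⊆ T := Finset.union_subset hZT hQT
  have hTeq : T = T₁ ∪ (A ∪ (Z ∪ Q)) := by
    ext s
    have := @hT₁T s
    simp only [hA, hZ, hQ, Finset.mem_union, Finset.mem_filter, Finset.mem_sdiff]
    tauto
  have hZQ : Disjoint Z Q := by
    rw [Finset.disjoint_left]
    simp only [hZ, hQ, Finset.mem_filter]
    tauto
  have hAZQ : Disjoint A (Z ∪ Q) := by
    rw [Finset.disjoint_left]
    simp only [hA, hZ, hQ, Finset.mem_filter, Finset.mem_union]
    tauto
  have h1 : ∀ R ⊆ T \ T₁, Disjoint T₁ R := fun R hR =>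
    Finset.disjoint_sdiff.mono_right hR
  have h1A : Disjoint T₁ A := h1 _ (Finset.filter_subset _ _)
  have h1ZQ : Disjoint T₁ (Z ∪ Q) :=
    h1 _ (Finset.union_subset (Finset.filter_subset _ _) (Finset.filter_subset _ _))
  have h1AZQ : Disjoint T₁ (A ∪ (Z ∪ Q)) := Finset.disjoint_union_right.2 ⟨h1A, h1ZQ⟩
  have hcrit : ∀ s ∈ T₁, ∃ x y z, IsCriticalLabelling H T M s x y z := fun s hs => by
    obtain ⟨hsT, e₁, he1, e₂, he2, hne, hs1, hs2⟩ := (hT₁ s).1 hs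
    exact h.exists_isCriticalLabelling hsT he1 he2 hne hs1 hs2
  have hns : ∀ s ∈ T \ T₁, ∀ e₁ ∈ M, ∀ e₂ ∈ M, e₁ ≠ e₂ → sees H e₁ s → sees H e₂ s → False :=
    fun s hs e₁ he1 e₂ he2 hne hs1 hs2 => (Finset.mem_sdiff.1 hs).2
      ((hT₁ s).2 ⟨(Finset.mem_sdiff.1 hs).1, e₁, he1, e₂, he2, hne, hs1, hs2⟩)
  have hAd : ∀ s ∈ A, IsDoublySeen H M I s := fun s hs => (Finset.mem_filter.1 hs).2
  have f11 := h.1.famCount_self_add_le hT₁T (c := 1) fun s hs s' hs' hne => by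
    obtain ⟨x, y, z, l⟩ := hcrit s hs
    obtain ⟨x', y', z', l'⟩ := hcrit s' hs'
    exact l'.crossCount_le_seven h l hne.symm
  have h1A8 : ∀ s ∈ T₁, ∀ s' ∈ A, crossCount H s s' ≤ 8 := fun s hs s' hs' => by
    obtain ⟨x, y, z, l⟩ := hcrit s hs
    obtain ⟨p, hp, hps⟩ := (hAd s' hs').exists_vertexSees
    exact l.crossCount_le_eight h (hAT hs') (Finset.disjoint_iff_ne.1 h1A _ hs _ hs')
      (h.1.partOf_notMem_of_mem_indep hp) hps
  have f1A := famCount_critical_le h hcrit hAT h1A (c := 1) h1A8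
  have f1A' : famCount H T₁ A ≤ 8 * T₁.card * A.card := famCount_le_of_forall fun s' hs' => by
    have := Finset.sum_le_card_nsmul T₁ (fun s => crossCount H s s') 8 fun s hs => h1A8 s hs s' hs'
    rwa [smul_eq_mul, mul_comm] at this
  have f1ZQ := famCount_critical_le h hcrit hZQT h1ZQ (c := 2) fun s hs s' hs' =>
    h.1.crossCount_le_nine (hT₁T hs) (hZQT hs')
  have fAA := h.1.famCount_self_add_le hAT (c := 2) fun s hs s' hs' hne =>
    (hAd s hs).crossCount_le_eight h (hAT hs) (hAT hs') hne (hAd s' hs')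
  have fAZQ := famCount_doublySeen_le h hAT hAd hZQT hAZQ
  have fZZ := famCount_triplySeen_le h hZT fun s hs => (Finset.mem_filter.1 hs).2.2
  have fZQ := famCount_le_nine h.1 hZT hQT
  have fQQ := h.1.famCount_self_add_le hQT (c := 3) fun s hs s' hs' _ =>
    h.1.crossCount_le_nine (hQT hs) (hQT hs')
  have o1 := Finset.sum_le_card_nsmul T₁ (fun s => crossCount H s (M.biUnion id ∪ I)) _
    fun s hs => by
    obtain ⟨x, y, z, l⟩ := hcrit s hs
    exact l.crossCount_outside_le h
  have oA := Finset.sum_le_card_nsmul A (fun s => crossCount H s (M.biUnion id ∪ I)) _ fun s hs =>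
    (hAd s hs).crossCount_outside_le h (hAT hs) (hns s (Finset.mem_filter.1 hs).1)
  have oZ := Finset.sum_le_card_nsmul Z (fun s => crossCount H s (M.biUnion id ∪ I)) _ fun s hs =>
    h.crossCount_outside_le_of_not_isDoublySeen (hZT hs) (Finset.mem_filter.1 hs).2.1
      (hns s (Finset.mem_filter.1 hs).1)
  have oQ := Finset.sum_le_card_nsmul Q (fun s => crossCount H s (M.biUnion id ∪ I)) _ fun s hs =>
    h.crossCount_outside_le_of_not_isTriplySeen (hQT hs) (Finset.mem_filter.1 hs).2.2
  have hout := h.crossCount_outside_le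
  have hdec := h.1.two_mul_ncard_edgeSet_eq
  have hfam : ∑ s ∈ T, ∑ s' ∈ T, crossCount H s s' = famCount H T T := rfl
  have hself : famCount H T T = famCount H T₁ T₁ + 2 * (famCount H T₁ A + famCount H T₁ (Z ∪ Q)) +
      (famCount H A A + 2 * famCount H A (Z ∪ Q) +
        (famCount H Z Z + 2 * famCount H Z Q + famCount H Q Q)) := by
    rw [hTeq, famCount_union_self h1AZQ, famCount_union_self hAZQ, famCount_union_self hZQ,
      famCount_comm T₁ (A ∪ (Z ∪ Q)), famCount_union_left hAZQ, famCount_comm A T₁,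
      famCount_comm (Z ∪ Q) T₁]
  have hsum : ∑ s ∈ T, crossCount H s (M.biUnion id ∪ I) =
      ∑ s ∈ T₁, crossCount H s (M.biUnion id ∪ I) + (∑ s ∈ A, crossCount H s (M.biUnion id ∪ I) +
      (∑ s ∈ Z, crossCount H s (M.biUnion id ∪ I) +
        ∑ s ∈ Q, crossCount H s (M.biUnion id ∪ I))) := by
    conv_lhs => rw [hTeq]
    rw [Finset.sum_union h1AZQ, Finset.sum_union hAZQ, Finset.sum_union hZQ]
  rw [hfam, hself, hsum] at hdec
  rw [Finset.card_union_of_disjoint hZQ] at f1ZQ fAZQ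
  refine ⟨A.card, Z.card, Q.card, famCount H T₁ A, ?_, f1A', f1A, ?_⟩
  · conv_lhs => rw [hTeq]
    rw [Finset.card_union_of_disjoint h1AZQ, Finset.card_union_of_disjoint hAZQ,
      Finset.card_union_of_disjoint hZQ]
    ring
  · simp only [smul_eq_mul] at o1 oA oZ oQ
    rw [show (6 + 1 : ℕ) = 7 from rfl] at f11
    rw [show (6 + 2 : ℕ) = 8 from rfl] at fAA
    rw [show (6 + 3 : ℕ) = 9 from rfl] at fQQ
    linarith

end EdgeBound

section Extremal

variable {n : ℕ}

lemma ncard_edgeSet_le_exTriangles {H : SimpleGraph (Fin n)} {k : ℕ}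
    (hH : ¬ HasKDisjointTriangles H k) : H.edgeSet.ncard ≤ exTriangles n k := by
  refine le_csSup ⟨Nat.card (Sym2 (Fin n)), ?_⟩ ⟨H, hH, rfl⟩
  rintro _ ⟨G, -, rfl⟩
  rw [← Set.ncard_univ]
  exact Set.ncard_le_ncard (Set.subset_univ _)

/-- The join of a complete graph with the complete bipartite graph with parts `A` and `B`. -/
def joinGraph (A B : Finset (Fin n)) : SimpleGraph (Fin n) where
  Adj x y := x ≠ y ∧ ¬ (x ∈ A ∧ y ∈ A) ∧ ¬ (x ∈ B ∧ y ∈ B)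
  symm := ⟨fun _ _ h => ⟨h.1.symm, fun h' => h.2.1 h'.symm, fun h' => h.2.2 h'.symm⟩⟩
  loopless := ⟨fun _ h => h.1 rfl⟩

lemma not_hasKDisjointTriangles_joinGraph {X A B : Finset (Fin n)} {t : ℕ} (hX : X.card = t)
    (hcov : ∀ x, x ∈ X ∨ x ∈ A ∨ x ∈ B) : ¬ HasKDisjointTriangles (joinGraph A B) (t + 1) := by
  rintro ⟨F, hF, htri, hd⟩
  have hmeet : ∀ s ∈ F, ∃ x ∈ s, x ∈ X := by
    intro s hs
    by_contra! hcon
    obtain ⟨a, b, c, hab, hac, hbc, rfl⟩ := SimpleGraph.is3Clique_iff.1 (htri s hs)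
    have h1 := hcon a (by simp)
    have h2 := hcon b (by simp)
    have h3 := hcon c (by simp)
    have h4 := hcov a
    have h5 := hcov b
    have h6 := hcov c
    obtain ⟨-, hab⟩ := hab
    obtain ⟨-, hac⟩ := hac
    obtain ⟨-, hbc⟩ := hbc
    tauto
  choose f hfs hfX using hmeet
  have := Finset.card_le_card_of_injOn (s := F.attach) (t := X) (fun s => f s.1 s.2)
    (fun s _ => hfX s.1 s.2) fun s _ s' _ heq => by
      by_contra hne
      refine Finset.disjoint_left.1 (hd s.2 s'.2 fun h => hne (Subtype.ext h)) (hfs s.1 s.2) ?_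
      exact (show f s.1 s.2 = f s'.1 s'.2 from heq) ▸ hfs s'.1 s'.2
  rw [Finset.card_attach] at this
  omega

lemma card_mul_le_crossCount {H : SimpleGraph (Fin n)} {S : Finset (Fin n)} {c : ℕ}
    (hc : ∀ x ∈ S, ∃ R : Finset (Fin n), R.card = c ∧ ∀ y, ¬ H.Adj x y → y ∈ R) :
    S.card * n ≤ crossCount H S univ + S.card * c := by
  classical
  have hrow : ∀ x ∈ S, n ≤ nbrCount H x univ + c := by
    intro x hx
    obtain ⟨R, rfl, hR⟩ := hc x hx
    have h1 : nbrCount H x univ = (univ.filter fun y => H.Adj x y).card := by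
      unfold nbrCount adjInd
      rw [Finset.sum_boole, Nat.cast_id]
    have h2 := Finset.card_filter_add_card_filter_not (s := (univ : Finset (Fin n)))
      (fun y => H.Adj x y)
    have h3 : (univ.filter fun y => ¬ H.Adj x y).card ≤ R.card :=
      Finset.card_le_card fun y hy => hR y (Finset.mem_filter.1 hy).2
    rw [Finset.card_univ, Fintype.card_fin] at h2
    omega
  have := Finset.card_nsmul_le_sum S _ n hrow
  rwa [Finset.sum_add_distrib, Finset.sum_const, smul_eq_mul, smul_eq_mul] at this

lemma le_exTriangles {t : ℕ} (ht : t ≤ n) :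
    2 * n ^ 2 ≤ 4 * exTriangles n (t + 1) + 2 * t + (n - t) ^ 2 + 1 := by
  obtain ⟨X, -, hX⟩ := Finset.exists_subset_card_eq (show t ≤ (univ : Finset (Fin n)).card by
    simpa using ht)
  have hXc : (univ \ X).card = n - t := by
    rw [Finset.card_sdiff_of_subset (Finset.subset_univ _), hX, Finset.card_univ, Fintype.card_fin]
  obtain ⟨A, hAX, hA⟩ := Finset.exists_subset_card_eq (show (n - t) / 2 ≤ (univ \ X).card by omega)
  set B := (univ \ X) \ A with hB
  have hBc : B.card = (n - t) - (n - t) / 2 := by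
    rw [hB, Finset.card_sdiff_of_subset hAX, hXc, hA]
  have hcov : ∀ x, x ∈ X ∨ x ∈ A ∨ x ∈ B := fun x => by
    simp only [hB, Finset.mem_sdiff, Finset.mem_univ, true_and]
    tauto
  have hXA : ∀ x ∈ X, x ∉ A := fun x hx hxA => (Finset.mem_sdiff.1 (hAX hxA)).2 hx
  have hXB : ∀ x ∈ X, x ∉ B := fun x hx hxB =>
    (Finset.mem_sdiff.1 (Finset.mem_sdiff.1 hxB).1).2 hx
  have hAB : ∀ x ∈ A, x ∉ B := fun x hx hxB => (Finset.mem_sdiff.1 hxB).2 hx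
  set G := joinGraph A B with hG
  have hnadj : ∀ x y, ¬ G.Adj x y → x = y ∨ (x ∈ A ∧ y ∈ A) ∨ (x ∈ B ∧ y ∈ B) := fun x y h => by
    by_contra hcon
    push Not at hcon
    exact h ⟨hcon.1, fun h' => hcon.2.1 h'.1 h'.2, fun h' => hcon.2.2 h'.1 h'.2⟩
  have h1 := card_mul_le_crossCount (H := G) (S := X) (c := 1) fun x hx =>
    ⟨{x}, Finset.card_singleton x, fun y hy => by
      have := hnadj x y hy
      have := hXA x hx
      have := hXB x hx
      simp only [Finset.mem_singleton]
      tauto⟩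
  have h2 := card_mul_le_crossCount (H := G) (S := A) fun x hx => ⟨A, rfl, fun y hy => by
    have := hAB x hx
    rcases hnadj x y hy with rfl | h | h
    · exact hx
    · exact h.2
    · exact absurd h.1 this⟩
  have h3 := card_mul_le_crossCount (H := G) (S := B) fun x hx => ⟨B, rfl, fun y hy => by
    rcases hnadj x y hy with rfl | h | h
    · exact hx
    · exact absurd hx (hAB x h.1)
    · exact h.2⟩
  have hle := ncard_edgeSet_le_exTriangles (not_hasKDisjointTriangles_joinGraph hX hcov)
  rw [← hG] at hle
  have hedge := two_mul_ncard_edgeSet (H := G)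
  have huniv : (univ : Finset (Fin n)) = X ∪ (A ∪ B) := by
    ext x
    simpa using hcov x
  have hsplit : crossCount G univ univ =
      crossCount G X univ + (crossCount G A univ + crossCount G B univ) := by
    rw [← crossCount_union_left (Finset.disjoint_left.2 hAB), ← crossCount_union_left
      (Finset.disjoint_union_right.2 ⟨Finset.disjoint_left.2 hXA, Finset.disjoint_left.2 hXB⟩),
      ← huniv]
  obtain ⟨m, rfl⟩ : ∃ m, n = t + m := ⟨n - t, by omega⟩
  rw [Nat.add_sub_cancel_left] at *
  rw [hX] at h1
  rcases Nat.even_or_odd' m with ⟨k, hk | hk⟩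
  · have hA' : A.card = k := by omega
    have hB' : B.card = k := by omega
    rw [hA'] at h2
    rw [hB'] at h3
    subst hk
    linarith
  · have hA' : A.card = k := by omega
    have hB' : B.card = k + 1 := by omega
    rw [hA'] at h2
    rw [hB'] at h3
    subst hk
    linarith

lemma IsMaxTilingTriple.card_left_eq {H : SimpleGraph (Fin n)} {T M : Finset (Finset (Fin n))}
    {I : Finset (Fin n)} (h : IsMaxTilingTriple H T M I) {k : ℕ}
    (h1 : HasKDisjointTriangles H k) (h2 : ¬ HasKDisjointTriangles H (k + 1)) : T.card = k := by
  refine le_antisymm ?_ ?_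
  · by_contra hlt
    obtain ⟨F, hF, hc⟩ := Finset.exists_subset_card_eq (show k + 1 ≤ T.card by omega)
    exact h2 ⟨F, hc, fun s hs => h.1.1 s (hF hs), h.1.pairwise_left.mono (by exact_mod_cast hF)⟩
  · obtain ⟨F, hc, htri, hd⟩ := h1
    rcases h.card_le (M' := ∅) htri (by simp) (by simpa using hd) with h3 | h3 <;> omega

end Extremal

section Arithmetic

lemma class_sizes_le_two {u a z q m i : ℤ} (hu : 0 ≤ u) (ha : 0 ≤ a) (hz : 0 ≤ z) (hq : 0 ≤ q)
    (hi : 0 ≤ i) (hk : 200 ≤ u + a + z + q) (hL : 3 * (u + a + z + q) + 15 ≤ 2 * (2 * m + i))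
    (hD : i ^ 2 + 4 * a * m + 4 * i * q + 4 * i * z + 8 * m * q + 4 * m * z ≤
      2 * a ^ 2 + 4 * a * q + 4 * a * z + 4 * q ^ 2 + 8 * q * z + 2 * z ^ 2 + 14 * a + 2 * i +
        4 * m + 28 * q + 4 * u + 38 * z - 8)
    (hD0 : u = 0 → i ^ 2 + 4 * a * m + 4 * i * q + 4 * i * z + 8 * m * q + 4 * m * z ≤
      2 * a ^ 2 + 4 * a * q + 4 * a * z + 4 * q ^ 2 + 8 * q * z + 2 * z ^ 2 + 10 * a + 2 * i +
        4 * m + 28 * q + 4 * u + 38 * z - 8) :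
    a + z + q ≤ 2 := by
  by_contra! hr
  have hL' : 0 ≤ (a + z + 2 * q - 1) * (2 * (2 * m + i) - (3 * (u + a + z + q) + 15)) :=
    mul_nonneg (by linarith) (by linarith)
  have hu3 : 0 ≤ u * (a + z + q - 3) := mul_nonneg hu (by linarith)
  have hzq := mul_nonneg hz hq
  have haq := mul_nonneg ha hq
  have haz := mul_nonneg ha hz
  have huq := mul_nonneg hu hq
  rcases le_or_gt z a with hza | hza
  · have hsq := sq_nonneg (i - (a - z))
    have hE : 4 * a * z + 5 * a * q + z * q + 2 * q ^ 2 + 3 * u * (a + z + 2 * q) - 2 * a - 26 * z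
        - q - 7 * u - 7 ≤ 0 := by linarith
    have hE0 : u = 0 → 4 * a * z + 5 * a * q + z * q + 2 * q ^ 2 + 3 * u * (a + z + 2 * q) + 2 * a
        - 26 * z - q - 7 * u - 7 ≤ 0 := fun h0 => by linarith [hD0 h0]
    rcases le_or_gt 50 u with hu50 | hu50
    · nlinarith [mul_nonneg (sub_nonneg.2 hu50) (show 0 ≤ a + z + q by linarith)]
    rcases le_or_gt 14 a with ha14 | ha14
    · have haz' := mul_nonneg (sub_nonneg.2 ha14) hz
      rcases hu.eq_or_lt with h0 | h0
      · have := hE0 h0.symm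
        subst h0
        nlinarith
      · nlinarith [mul_nonneg (show 0 ≤ u - 1 by linarith) (show 0 ≤ a + z + q - 3 by linarith)]
    · nlinarith [mul_nonneg (show 0 ≤ q - 100 by linarith) hq]
  · have hE : (a + z) ^ 2 + 5 * a * q + z * q + 2 * q ^ 2 + 3 * u * (a + z + 2 * q) - 2 * a - 26 * z
        - q - 7 * u - 7 ≤ 0 := by
      nlinarith [mul_nonneg hi (show 0 ≤ z - a by linarith), sq_nonneg i]
    rcases le_or_gt 50 u with hu50 | hu50
    · nlinarith [mul_nonneg (sub_nonneg.2 hu50) (show 0 ≤ a + z + q by linarith), sq_nonneg (a + z)]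
    rcases le_or_gt 50 q with hq50 | hq50
    · nlinarith [sq_nonneg (a + z - 13), mul_nonneg (sub_nonneg.2 hq50) hq]
    · nlinarith [mul_nonneg (show 0 ≤ a + z - 50 by linarith) (show 0 ≤ a + z by linarith),
        sq_nonneg (q - 1)]

lemma sq_lt_of_class_sizes_le_two {u a z q m i : ℤ} (ha : 0 ≤ a) (hz : 0 ≤ z)
    (hq : 0 ≤ q) (hi : 0 ≤ i) (hm : 0 ≤ m) (hk : 200 ≤ u + a + z + q) (hr : a + z + q ≤ 2)
    (hD : i ^ 2 + 4 * a * m + 4 * i * q + 4 * i * z + 8 * m * q + 4 * m * z ≤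
      2 * a ^ 2 + 4 * a * q + 4 * a * z + 4 * q ^ 2 + 8 * q * z + 2 * z ^ 2 + 14 * a + 2 * i +
        4 * m + 28 * q + 4 * u + 38 * z - 8) :
    i ^ 2 < 2 * (3 * (u + a + z + q) + 2 * m + i) := by
  have h1 := mul_nonneg ha hm
  have h2 := mul_nonneg hi hq
  have h3 := mul_nonneg hi hz
  have h4 := mul_nonneg hm hq
  have h5 := mul_nonneg hm hz
  have h6 : (a + z + q) ^ 2 ≤ 4 := by nlinarith
  nlinarith [mul_nonneg ha hz, mul_nonneg ha hq, mul_nonneg hz hq, sq_nonneg a, sq_nonneg z,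
    sq_nonneg q]

end Arithmetic

/-- stability. For every `δ > 0` there is `N(δ)` such that for all
`n ≥ N(δ)`, every integer `t` with `δn ≤ t ≤ (2n−6)/9 − 2`, every `(t+2)K₃`-free graph
`H` on `n` vertices with exactly `ex(n,(t+1)K₃) + 2` edges, every maximal tiling triple
`(T, M, I)` of `H` and every ideal partition `(T₁, T₂, T₃, T₄)` of `T` satisfy:
(i) `t−1 ≤ |T₁| ≤ t+1`; (ii) `(n−3(t+1))/2 − √(2n)/2 < |M| ≤ (n−3(t+1))/2`;
(iii) `|I| < √(2n)`. -/
theorem statement6 (δ : ℝ) (hδ : 0 < δ) :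
    ∃ N : ℕ, ∀ n : ℕ, N ≤ n → ∀ t : ℕ,
      δ * n ≤ t → (t : ℝ) ≤ (2 * n - 6) / 9 - 2 →
      ∀ H : SimpleGraph (Fin n),
        ¬ HasKDisjointTriangles H (t + 2) →
        H.edgeSet.ncard = exTriangles n (t + 1) + 2 →
        ∀ (T M : Finset (Finset (Fin n))) (I : Finset (Fin n)),
          IsMaxTilingTriple H T M I →
          ∀ T₁ T₂ T₃ T₄ : Finset (Finset (Fin n)),
            IsIdealPartition H T M I T₁ T₂ T₃ T₄ →
            (t - 1 ≤ T₁.card ∧ T₁.card ≤ t + 1) ∧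
            (((n : ℝ) - 3 * (t + 1)) / 2 - Real.sqrt (2 * n) / 2 < M.card ∧
              (M.card : ℝ) ≤ ((n : ℝ) - 3 * (t + 1)) / 2) ∧
            (I.card : ℝ) < Real.sqrt (2 * n) := by
  refine ⟨⌈200 / δ⌉₊, fun n hn t ht1 ht2 H hfree hcard T M I h T₁ T₂ T₃ T₄ hP => ?_⟩
  have hT₁ := hP.2.2.2.2.2.2.2.1
  have ht200 : 200 ≤ t := by
    have h1 := (Nat.le_ceil (200 / δ)).trans (Nat.cast_le.2 hn)
    rw [div_le_iff₀' hδ] at h1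
    exact_mod_cast h1.trans ht1
  have htn : 9 * t + 24 ≤ 2 * n := by
    have h1 : (9 * t + 24 : ℝ) ≤ 2 * n := by linarith
    exact_mod_cast h1
  have hhas : HasKDisjointTriangles H (t + 1) := by
    by_contra hno
    have := ncard_edgeSet_le_exTriangles hno
    omega
  have hT := h.card_left_eq hhas hfree
  have hn' := h.1.card_eq
  have hex := le_exTriangles (n := n) (t := t) (by omega)
  obtain ⟨a, z, q, X, hsum, hX, hX', hup⟩ := h.two_mul_ncard_edgeSet_le hT₁
  rw [hcard] at hup
  rw [hT] at hsum hn'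
  generalize hu : T₁.card = u at *
  generalize hm : M.card = m at *
  generalize hi : I.card = i at *
  zify [show t ≤ n by omega] at hex hup hX hX' hsum hn' htn ht200
  have hnZ : (n : ℤ) = 3 * (u + a + z + q) + 2 * m + i := by linarith
  have htZ : (t : ℤ) = u + a + z + q - 1 := by linarith
  have hlow : 2 * (n : ℤ) ^ 2 ≤ 4 * exTriangles n (t + 1) + 2 * t + (n - t) ^ 2 + 1 := hex
  generalize (exTriangles n (t + 1) : ℤ) = E at hup hlow
  rw [htZ, hnZ] at hlow
  have hD : (i : ℤ) ^ 2 + 4 * a * m + 4 * i * q + 4 * i * z + 8 * m * q + 4 * m * z ≤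
      2 * a ^ 2 + 4 * a * q + 4 * a * z + 4 * q ^ 2 + 8 * q * z + 2 * z ^ 2 + 14 * a + 2 * i +
        4 * m + 28 * q + 4 * u + 38 * z - 8 := by linarith
  have hD0 : (u : ℤ) = 0 → (i : ℤ) ^ 2 + 4 * a * m + 4 * i * q + 4 * i * z + 8 * m * q + 4 * m * z ≤
      2 * a ^ 2 + 4 * a * q + 4 * a * z + 4 * q ^ 2 + 8 * q * z + 2 * z ^ 2 + 10 * a + 2 * i +
        4 * m + 28 * q + 4 * u + 38 * z - 8 := by
    intro h0
    rw [h0] at hX hup hlow ⊢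
    linarith
  have hr := class_sizes_le_two (Int.natCast_nonneg u) (Int.natCast_nonneg a)
    (Int.natCast_nonneg z) (Int.natCast_nonneg q) (Int.natCast_nonneg i)
    (by linarith) (by linarith) hD hD0
  have hsq := sq_lt_of_class_sizes_le_two (Int.natCast_nonneg a) (Int.natCast_nonneg z)
    (Int.natCast_nonneg q) (Int.natCast_nonneg i) (Int.natCast_nonneg m) (by linarith) hr hD
  have hI : (i : ℝ) < Real.sqrt (2 * n) := by
    refine Real.lt_sqrt_of_sq_lt ?_
    have h1 : (i : ℤ) ^ 2 < 2 * n := by linarith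
    exact_mod_cast h1
  have hnR : (n : ℝ) = 3 * (t + 1) + 2 * m + i := by exact_mod_cast hn'
  refine ⟨by omega, ⟨by linarith, ?_⟩, hI⟩
  have : (0 : ℝ) ≤ i := Nat.cast_nonneg i
  linarith
end

section
/- There exists N0 such that the following holds for all integers n ≥ N0. Let n, t, m, i be positive integers with 2m + i = n − 3(t+1) and t ≤ (2n−6)/9 − 2. Then h(t+1, 0, 0, 0, m, i) = f(t+1, 0, 0, 0, m, i) + i·m + m² ≤ e1(n,t) + (−i² + 2n − 2t − 2)/4. -/
/-- `binom(x, 2) = x(x−1)/2`, extended to the reals. -/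
noncomputable def choose2 (x : ℝ) : ℝ := x * (x - 1) / 2

/-- The function `f(τ₁, τ₂, τ₃, τ₄, μ, ι)` from the paper. -/
noncomputable def fFun (τ₁ τ₂ τ₃ τ₄ μ ι : ℝ) : ℝ :=
  4 * μ * τ₁ + 2 * ι * τ₁ + 7 * choose2 τ₁ + 3 * τ₁ + 2 * ι * τ₂ + 8 * choose2 τ₂
    + 3 * τ₂ + 8 * choose2 τ₃ + 8 * τ₃ * τ₄ + 3 * τ₃ + 7 * τ₁ * τ₂ + (2 + 3 * μ) * τ₂
    + 7 * τ₁ * (τ₃ + τ₄) + (3 + 3 * μ) * τ₃ + 8 * τ₂ * (τ₃ + τ₄) + (2 + ι) * τ₃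

/-- The function `h(τ₁, τ₂, τ₃, τ₄, μ, ι)` from the paper. -/
noncomputable def hFun (τ₁ τ₂ τ₃ τ₄ μ ι : ℝ) : ℝ :=
  fFun τ₁ τ₂ τ₃ τ₄ μ ι + ι * μ + μ ^ 2 + (3 * μ + 3) * τ₄ + (ι + 2) * τ₄
    + choose2 (3 * τ₄)

/-- `e₁(n,t) = binom(t,2) + t(n−t) + ⌈(n−t)/2⌉⌊(n−t)/2⌋`, the number of edges of the
construction `E₁(n,t)`. -/
def e1 (n t : ℕ) : ℕ :=
  t.choose 2 + t * (n - t) + ((n - t + 1) / 2) * ((n - t) / 2)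

/-- The product `⌈k/2⌉⌊k/2⌋` is at least `(k² - 1)/4`. -/
theorem sq_sub_one_div_four_le_half_mul_half (k : ℕ) :
    ((k : ℝ) ^ 2 - 1) / 4 ≤ (((k + 1) / 2 * (k / 2) : ℕ) : ℝ) := by
  obtain ⟨a, rfl | rfl⟩ := k.even_or_odd'
  · rw [show (2 * a + 1) / 2 = a by omega, show 2 * a / 2 = a by omega]
    push_cast
    nlinarith
  · rw [show (2 * a + 1 + 1) / 2 = a + 1 by omega, show (2 * a + 1) / 2 = a by omega]
    push_cast
    nlinarith

theorem e1_lower_bound {n t : ℕ} (h : t ≤ n) :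
    (t : ℝ) * (t - 1) / 2 + t * (n - t) + (((n : ℝ) - t) ^ 2 - 1) / 4 ≤ (e1 n t : ℝ) := by
  have hhalf := sq_sub_one_div_four_le_half_mul_half (n - t)
  rw [Nat.cast_sub h] at hhalf
  rw [e1, Nat.cast_add, Nat.cast_add, Nat.cast_choose_two, Nat.cast_mul t, Nat.cast_sub h]
  linarith

/-- (Fact 2.4 b)). For sufficiently large `n`, positive integers
`t, m, i` with `2m + i = n − 3(t+1)` and `t ≤ (2n−6)/9 − 2` satisfy
`h(t+1, 0, 0, 0, m, i) = f(t+1, 0, 0, 0, m, i) + im + m² ≤ e₁(n,t) + (−i² + 2n − 2t − 2)/4`. -/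
theorem statement9 :
    ∃ N₀ : ℕ, ∀ n : ℕ, N₀ ≤ n → ∀ t m i : ℕ,
      0 < t → 0 < m → 0 < i →
      (2 * m + i : ℝ) = n - 3 * (t + 1) →
      (t : ℝ) ≤ (2 * n - 6) / 9 - 2 →
      hFun (t + 1) 0 0 0 m i = fFun (t + 1) 0 0 0 m i + i * m + (m : ℝ) ^ 2 ∧
      hFun (t + 1) 0 0 0 m i ≤ (e1 n t : ℝ) + (-(i : ℝ) ^ 2 + 2 * n - 2 * t - 2) / 4 := by
  refine ⟨0, fun n _ t m i _ _ _ hn _ => ⟨by simp [hFun, choose2], ?_⟩⟩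
  have htn : t ≤ n := by
    have hn' : (2 * m + i + 3 * (t + 1) : ℝ) = n := by linarith
    norm_cast at hn'
    omega
  have he := e1_lower_bound htn
  have hi : (i : ℝ) = n - 3 * (t + 1) - 2 * m := by linarith
  refine le_trans (le_of_eq ?_) (add_le_add_left he _)
  simp only [hFun, fFun, choose2]
  rw [hi]
  ring
end

section
/- For all non-negative integers τ1, τ2, τ3, τ4, μ, ι: f(τ1, τ2, τ3, τ4, μ, ι) ≤ max{ f(τ1+τ2, 0, τ3, τ4, μ, ι), f(0, τ1+τ2, τ3, τ4, μ, ι) }, with equality only if τ1·τ2 = 0. Moreover, h(τ1, τ2, τ3, τ4, μ, ι) ≤ h(τ1, τ2, 0, τ3+τ4, μ, ι). -/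
/-- Along the segment of fixed `a + b`, `fFun` is quadratic with leading coefficient `1 / 2`,
and so differs from its chord by the given product. -/
theorem add_mul_fFun (a b c d m i : ℝ) :
    (a + b) * fFun a b c d m i =
      a * fFun (a + b) 0 c d m i + b * fFun 0 (a + b) c d m i - a * b * (a + b) / 2 := by
  unfold fFun choose2
  ring

theorem fFun_zero_left_or_right_le_max {a b : ℝ} (c d m i : ℝ) (hab : a * b = 0) :
    fFun a b c d m i ≤ max (fFun (a + b) 0 c d m i) (fFun 0 (a + b) c d m i) := by
  rcases mul_eq_zero.mp hab with rfl | rfl <;> simp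

theorem fFun_lt_max {a b : ℝ} (c d m i : ℝ) (ha : 0 < a) (hb : 0 < b) :
    fFun a b c d m i < max (fFun (a + b) 0 c d m i) (fFun 0 (a + b) c d m i) := by
  have hs : 0 < a + b := add_pos ha hb
  have hprod : 0 < a * b * (a + b) := by positivity
  refine lt_of_mul_lt_mul_left ?_ hs.le
  have hleft := mul_le_mul_of_nonneg_left
    (le_max_left (fFun (a + b) 0 c d m i) (fFun 0 (a + b) c d m i)) ha.le
  have hright := mul_le_mul_of_nonneg_left
    (le_max_right (fFun (a + b) 0 c d m i) (fFun 0 (a + b) c d m i)) hb.le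
  rw [add_mul_fFun, add_mul a b (max _ _)]
  linarith

theorem hFun_zero_add (a b c d m i : ℝ) :
    hFun a b 0 (c + d) m i = hFun a b c d m i + choose2 c + c * d := by
  unfold hFun fFun choose2
  ring

theorem choose2_natCast_nonneg (n : ℕ) : 0 ≤ choose2 n := by
  rw [choose2, ← Nat.cast_choose_two]
  positivity

/-- Fact 2.5. For all non-negative integers `τ₁, …, ι`:
`f(τ₁,τ₂,τ₃,τ₄,μ,ι) ≤ max{f(τ₁+τ₂,0,τ₃,τ₄,μ,ι), f(0,τ₁+τ₂,τ₃,τ₄,μ,ι)}`, with equality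
only if `τ₁τ₂ = 0`; moreover `h(τ₁,τ₂,τ₃,τ₄,μ,ι) ≤ h(τ₁,τ₂,0,τ₃+τ₄,μ,ι)`. -/
theorem statement10 (τ₁ τ₂ τ₃ τ₄ μ ι : ℕ) :
    (fFun τ₁ τ₂ τ₃ τ₄ μ ι ≤
      max (fFun (τ₁ + τ₂) 0 τ₃ τ₄ μ ι) (fFun 0 (τ₁ + τ₂) τ₃ τ₄ μ ι)) ∧
    (fFun τ₁ τ₂ τ₃ τ₄ μ ι =
      max (fFun (τ₁ + τ₂) 0 τ₃ τ₄ μ ι) (fFun 0 (τ₁ + τ₂) τ₃ τ₄ μ ι) → τ₁ * τ₂ = 0) ∧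
    hFun τ₁ τ₂ τ₃ τ₄ μ ι ≤ hFun τ₁ τ₂ 0 (τ₃ + τ₄) μ ι := by
  refine ⟨?_, fun h => ?_, ?_⟩
  · by_cases h : τ₁ * τ₂ = 0
    · exact fFun_zero_left_or_right_le_max _ _ _ _ (mod_cast h)
    · obtain ⟨h₁, h₂⟩ := mul_ne_zero_iff.mp h
      exact (fFun_lt_max _ _ _ _ (mod_cast Nat.pos_of_ne_zero h₁) (mod_cast Nat.pos_of_ne_zero h₂)).le
  · by_contra hne
    obtain ⟨h₁, h₂⟩ := mul_ne_zero_iff.mp hne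
    exact (fFun_lt_max _ _ _ _ (mod_cast Nat.pos_of_ne_zero h₁) (mod_cast Nat.pos_of_ne_zero h₂)).ne h
  · have hprod : (0 : ℝ) ≤ τ₃ * τ₄ := by positivity
    rw [hFun_zero_add]
    linarith [choose2_natCast_nonneg τ₃]
end

section
/- For every δ > 0 there exists N(δ) such that the following holds for every n ≥ N(δ). Let t be an integer with δn ≤ t ≤ (2n−6)/9 + 1, and let t1, t2, t3, t4, m, i be non-negative integers satisfying t1 + t2 + t3 + t4 = t+1, 2m + i = n − 3(t+1), t1 ≥ t−1, m > (n−3(t+1))/2 − √(2n)/2, and i < √(2n). Then h(t1, t2, t3, t4, m, i) − m − t1 ≤ e1(n,t) + 1/4. -/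
/-- The number of edges of the construction is at least its smooth approximation, up to `1/4`. -/
theorem le_e1_add_quarter {n t : ℕ} (h : t ≤ n) :
    (t : ℝ) * (t - 1) / 2 + t * (n - t) + ((n : ℝ) - t) ^ 2 / 4 ≤ (e1 n t : ℝ) + 1 / 4 := by
  obtain ⟨k, rfl⟩ := Nat.exists_eq_add_of_le h
  have hk : ((k : ℝ) ^ 2 - 1) / 4 ≤ (((k + 1) / 2 : ℕ) : ℝ) * ((k / 2 : ℕ) : ℝ) := by
    rcases Nat.even_or_odd' k with ⟨j, rfl | rfl⟩
    · rw [show (2 * j + 1) / 2 = j by omega, show 2 * j / 2 = j by omega]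
      push_cast
      nlinarith
    · rw [show (2 * j + 1 + 1) / 2 = j + 1 by omega, show (2 * j + 1) / 2 = j by omega]
      push_cast
      nlinarith
  simp only [e1, Nat.add_sub_cancel_left, Nat.cast_add, Nat.cast_mul, Nat.cast_choose_two]
  linarith

/-- Fact 4.2. For every `δ > 0` and sufficiently large `n`, if
`δn ≤ t ≤ (2n−6)/9 + 1`, `t₁+t₂+t₃+t₄ = t+1`, `2m+i = n−3(t+1)`, `t₁ ≥ t−1`,
`m > (n−3(t+1))/2 − √(2n)/2` and `i < √(2n)`, then
`h(t₁,t₂,t₃,t₄,m,i) − m − t₁ ≤ e₁(n,t) + 1/4`. -/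
theorem statement11 (δ : ℝ) (hδ : 0 < δ) :
    ∃ N₀ : ℕ, ∀ n : ℕ, N₀ ≤ n → ∀ t t₁ t₂ t₃ t₄ m i : ℕ,
      δ * n ≤ t → (t : ℝ) ≤ (2 * n - 6) / 9 + 1 →
      t₁ + t₂ + t₃ + t₄ = t + 1 →
      (2 * m + i : ℝ) = n - 3 * (t + 1) →
      (t : ℝ) - 1 ≤ t₁ →
      ((n : ℝ) - 3 * (t + 1)) / 2 - Real.sqrt (2 * n) / 2 < m →
      (i : ℝ) < Real.sqrt (2 * n) →
      hFun t₁ t₂ t₃ t₄ m i - m - t₁ ≤ (e1 n t : ℝ) + 1 / 4 := by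
  refine ⟨10000, fun n hn t t₁ t₂ t₃ t₄ m i _ ht hsum hmi ht₁ hm _ => ?_⟩
  have hn' : (10000 : ℝ) ≤ n := by exact_mod_cast hn
  have hsqrt : Real.sqrt (2 * n) ≤ n / 50 := by
    rw [Real.sqrt_le_left (by positivity)]
    nlinarith
  have hm' : (100 : ℝ) ≤ m := by linarith
  have htn : t ≤ n := by
    have : (t : ℝ) ≤ n := by linarith
    exact_mod_cast this
  refine le_trans ?_ (le_e1_add_quarter htn)
  have hle : t₂ + t₃ + t₄ ≤ 2 := by
    have h : t ≤ t₁ + 1 := by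
      have : (t : ℝ) ≤ t₁ + 1 := by linarith
      exact_mod_cast this
    omega
  have hsum' : (t₁ : ℝ) + t₂ + t₃ + t₄ = t + 1 := by exact_mod_cast hsum
  have hi : (0 : ℝ) ≤ i := Nat.cast_nonneg i
  have hn_eq : (n : ℝ) = 2 * m + i + 3 * (t + 1) := by linarith
  have ht_eq : (t : ℝ) = t₁ + t₂ + t₃ + t₄ - 1 := by linarith
  rw [hn_eq, ht_eq]
  simp only [hFun, fFun, choose2]
  clear hsum hsum' hn_eq ht_eq hmi ht₁ ht hm
  have h₂ : t₂ ≤ 2 := by omega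
  have h₃ : t₃ ≤ 2 := by omega
  have h₄ : t₄ ≤ 2 := by omega
  interval_cases t₂ <;> interval_cases t₃ <;> interval_cases t₄ <;>
    first
      | omega
      | (push_cast; nlinarith [sq_nonneg ((i : ℝ) - 1)])
end

section
/- For every δ > 0 there exists N(δ) such that the following holds for every n ≥ N(δ). Let t be an integer with δn ≤ t ≤ (2n−6)/9 + 1, and let t1, t2, t3, t4, m, i be non-negative integers satisfying t1 + t2 + t3 + t4 = t+1, 2m + i = n − 3(t+1), t1 ≥ t−1, m > (n−3(t+1))/2 − √(2n)/2, and i < √(2n). Then h(t1, t2, t3, t4, m, i) ≤ e1(n,t) + (n − t − 1)/2. Moreover, if t1 ≤ t (i.e. t+1−t1 > 0), then h(t1, t2, t3, t4, m, i) ≤ e1(n,t) + t + 6. -/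
/-- A lower bound for `e1` with `n` expressed through the part sizes, via
`⌈a/2⌉⌊a/2⌋ ≥ (a² - 1)/4`. -/
lemma le_e1 (t m i : ℕ) :
    (t : ℝ) * (t - 1) / 2 + t * (2 * m + i + 2 * t + 3)
      + ((2 * m + i + 2 * t + 3 : ℝ) ^ 2 - 1) / 4 ≤ (e1 (2 * m + i + 3 * t + 3) t : ℝ) := by
  have hsub : 2 * m + i + 3 * t + 3 - t = 2 * m + i + 2 * t + 3 := by omega
  unfold e1
  rw [hsub]
  push_cast [Nat.cast_choose_two]
  rcases Nat.even_or_odd' i with ⟨k, rfl | rfl⟩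
  · have h₁ : (2 * m + 2 * k + 2 * t + 3 + 1) / 2 = m + k + t + 2 := by omega
    have h₂ : (2 * m + 2 * k + 2 * t + 3) / 2 = m + k + t + 1 := by omega
    rw [h₁, h₂]
    push_cast
    nlinarith
  · have h₁ : (2 * m + (2 * k + 1) + 2 * t + 3 + 1) / 2 = m + k + t + 2 := by omega
    have h₂ : (2 * m + (2 * k + 1) + 2 * t + 3) / 2 = m + k + t + 2 := by omega
    rw [h₁, h₂]
    push_cast
    nlinarith

/-- The hypotheses of the theorem force `m` to exceed `i / 2` by a large constant. -/
lemma add_le_two_mul {n t m i : ℝ} (hn : 10000 ≤ n) (ht : t ≤ (2 * n - 6) / 9 + 1)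
    (hsum : 2 * m + i = n - 3 * (t + 1)) (hi : i < Real.sqrt (2 * n)) : i + 100 ≤ 2 * m := by
  have hsqrt : Real.sqrt (2 * n) ≤ n / 50 :=
    Real.sqrt_le_iff.mpr ⟨by linarith, by nlinarith⟩
  linarith

/-- Fact 4.3. For every `δ > 0` and sufficiently large `n`, if
`δn ≤ t ≤ (2n−6)/9 + 1`, `t₁+t₂+t₃+t₄ = t+1`, `2m+i = n−3(t+1)`, `t₁ ≥ t−1`,
`m > (n−3(t+1))/2 − √(2n)/2` and `i < √(2n)`, then
`h(t₁,t₂,t₃,t₄,m,i) ≤ e₁(n,t) + (n−t−1)/2`; moreover, if `t₁ ≤ t`, then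
`h(t₁,t₂,t₃,t₄,m,i) ≤ e₁(n,t) + t + 6`. -/
theorem statement12 (δ : ℝ) (hδ : 0 < δ) :
    ∃ N₀ : ℕ, ∀ n : ℕ, N₀ ≤ n → ∀ t t₁ t₂ t₃ t₄ m i : ℕ,
      δ * n ≤ t → (t : ℝ) ≤ (2 * n - 6) / 9 + 1 →
      t₁ + t₂ + t₃ + t₄ = t + 1 →
      (2 * m + i : ℝ) = n - 3 * (t + 1) →
      (t : ℝ) - 1 ≤ t₁ →
      ((n : ℝ) - 3 * (t + 1)) / 2 - Real.sqrt (2 * n) / 2 < m →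
      (i : ℝ) < Real.sqrt (2 * n) →
      hFun t₁ t₂ t₃ t₄ m i ≤ (e1 n t : ℝ) + ((n : ℝ) - t - 1) / 2 ∧
      (t₁ ≤ t → hFun t₁ t₂ t₃ t₄ m i ≤ (e1 n t : ℝ) + t + 6) := by
  refine ⟨10000, ?_⟩
  intro n hn t t₁ t₂ t₃ t₄ m i _ ht hsum hmi ht₁ _ hi
  have hm := add_le_two_mul (by exact_mod_cast hn) ht hmi hi
  have hn_eq : n = 2 * m + i + 3 * t + 3 := by
    have : (n : ℝ) = ((2 * m + i + 3 * t + 3 : ℕ) : ℝ) := by push_cast; linarith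
    exact_mod_cast this
  subst hn_eq
  have he := le_e1 t m i
  clear hn ht hmi hi
  generalize (e1 (2 * m + i + 3 * t + 3) t : ℝ) = e at he ⊢
  have hi₀ : (0 : ℝ) ≤ i := Nat.cast_nonneg i
  have hsum' : (t₁ : ℝ) = t + 1 - t₂ - t₃ - t₄ := by
    have : (t₁ + t₂ + t₃ + t₄ : ℝ) = t + 1 := by exact_mod_cast hsum
    linarith
  have ht₁' : t ≤ t₁ + 1 := by
    have : (t : ℝ) ≤ t₁ + 1 := by linarith
    exact_mod_cast this
  have hcases : (t₂ = 0 ∧ t₃ = 0 ∧ t₄ = 0) ∨ (t₂ = 1 ∧ t₃ = 0 ∧ t₄ = 0) ∨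
      (t₂ = 0 ∧ t₃ = 1 ∧ t₄ = 0) ∨ (t₂ = 0 ∧ t₃ = 0 ∧ t₄ = 1) ∨
      (t₂ = 2 ∧ t₃ = 0 ∧ t₄ = 0) ∨ (t₂ = 0 ∧ t₃ = 2 ∧ t₄ = 0) ∨
      (t₂ = 0 ∧ t₃ = 0 ∧ t₄ = 2) ∨ (t₂ = 1 ∧ t₃ = 1 ∧ t₄ = 0) ∨
      (t₂ = 1 ∧ t₃ = 0 ∧ t₄ = 1) ∨ (t₂ = 0 ∧ t₃ = 1 ∧ t₄ = 1) := by omega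
  unfold hFun fFun choose2
  rw [hsum']
  push_cast
  rcases hcases with ⟨rfl, rfl, rfl⟩ | hcases
  · refine ⟨?_, fun h => by omega⟩
    push_cast
    linarith [sq_nonneg (i : ℝ)]
  · rcases hcases with ⟨rfl, rfl, rfl⟩ | ⟨rfl, rfl, rfl⟩ | ⟨rfl, rfl, rfl⟩ | ⟨rfl, rfl, rfl⟩ |
      ⟨rfl, rfl, rfl⟩ | ⟨rfl, rfl, rfl⟩ | ⟨rfl, rfl, rfl⟩ | ⟨rfl, rfl, rfl⟩ | ⟨rfl, rfl, rfl⟩ <;>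
    · push_cast
      refine ⟨?_, fun _ => ?_⟩ <;> linarith [sq_nonneg (i : ℝ), sq_nonneg ((i : ℝ) - 1)]
end
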